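/- arXiv:math/0607225 — 4 statements merged into one kernel-verified Lean document; each statement's English description precedes it below -/
import Mathlib

section
/- There exist s₁ < s₂ < s₃ < s₁ + π in ℝ/2πℤ such that for each i ∈ {1,2,3}, choosing vᵢ ∈ S² with ⟨vᵢ, γ̂(sᵢ)⟩ = ⟨vᵢ, γ̂′(sᵢ)⟩ = 0 (the normal of the tangent great circle of γ̂ at γ̂(sᵢ)), the function gᵢ(t) = ⟨vᵢ, γ̂(t)⟩ changes sign at exactly two connected components of its zero set in ℝ/2πℤ, namely those containing sᵢ and sᵢ + π. (Equivalently, the underlying anti-convex curve γ in P² has at least three inflection points whose tangent lines cross γ only once.) -/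
open Set Filter Topology Matrix

noncomputable section

/-- `g` (a `2π`-periodic continuous function) changes sign at the connected component
`[k₁,k₂]` of its zero set: there is an open interval `U = (u₁,u₂)` around `[k₁,k₂]` whose
only zeros of `g` are those in `[k₁,k₂]`, and `g` has opposite (nonzero) signs on the two
components `(u₁,k₁)` and `(k₂,u₂)` of `U ∖ [k₁,k₂]`. -/
def SignChange (g : ℝ → ℝ) (k₁ k₂ : ℝ) : Prop :=
  k₁ ≤ k₂ ∧ k₂ - k₁ < 2 * Real.pi ∧ (∀ t ∈ Icc k₁ k₂, g t = 0) ∧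
  ∃ u₁ u₂ : ℝ, u₁ < k₁ ∧ k₂ < u₂ ∧ u₂ - u₁ < 2 * Real.pi ∧
    (∀ t ∈ Ioo u₁ u₂, g t = 0 → t ∈ Icc k₁ k₂) ∧
    (((∀ t ∈ Ioo u₁ k₁, g t < 0) ∧ (∀ t ∈ Ioo k₂ u₂, 0 < g t)) ∨
     ((∀ t ∈ Ioo u₁ k₁, 0 < g t) ∧ (∀ t ∈ Ioo k₂ u₂, g t < 0)))

/-- `g` (a `2π`-periodic continuous function, viewed on `ℝ/2πℤ`) changes sign at exactly
two connected components of its zero set, namely those containing `s` and `s + π`. -/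
def TwoCleanCrossings (g : ℝ → ℝ) (s : ℝ) : Prop :=
  ∃ k₁ k₂ : ℝ, k₁ ≤ s ∧ s ≤ k₂ ∧
    SignChange g k₁ k₂ ∧ SignChange g (k₁ + Real.pi) (k₂ + Real.pi) ∧
    ∀ z : ℝ, g z = 0 →
      (∀ n : ℤ, z + 2 * Real.pi * n ∉ Icc k₁ k₂ ∧
        z + 2 * Real.pi * n ∉ Icc (k₁ + Real.pi) (k₂ + Real.pi)) →
      ¬ ∃ m₁ m₂ : ℝ, m₁ ≤ z ∧ z ≤ m₂ ∧ SignChange g m₁ m₂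

/-- The triple product `det (x, y, z)`. -/
def triple (x y z : Fin 3 → ℝ) : ℝ := (x ⨯₃ y) ⬝ᵥ z

lemma triple_expand (x y z : Fin 3 → ℝ) :
    triple x y z = x 0 * (y 1 * z 2 - y 2 * z 1) - x 1 * (y 0 * z 2 - y 2 * z 0)
      + x 2 * (y 0 * z 1 - y 1 * z 0) := by
  simp [triple, crossProduct, dotProduct, Fin.sum_univ_three]
  ring

lemma triple_neg_right (x y z : Fin 3 → ℝ) : triple x y (-z) = -triple x y z := by
  simp [triple]

lemma triple_neg_mid (x y z : Fin 3 → ℝ) : triple x (-y) z = -triple x y z := by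
  simp only [triple_expand, Pi.neg_apply]; ring

lemma triple_swap (x y z : Fin 3 → ℝ) : triple y x z = -triple x y z := by
  simp only [triple_expand]; ring

lemma triple_swap_right (x y z : Fin 3 → ℝ) : triple x z y = -triple x y z := by
  simp only [triple_expand]; ring

lemma triple_self_right (x y : Fin 3 → ℝ) : triple x y y = 0 := by
  simp only [triple_expand]; ring

lemma triple_self_left (x y : Fin 3 → ℝ) : triple x y x = 0 := by
  simp only [triple_expand]; ring

/-- Cramer's rule for four vectors in `ℝ³`, tested against a functional `u`. -/
lemma triple_cramer (u x y z v : Fin 3 → ℝ) :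
    (u ⬝ᵥ v) * triple x y z = (u ⬝ᵥ x) * triple v y z + (u ⬝ᵥ y) * triple x v z
      + (u ⬝ᵥ z) * triple x y v := by
  simp only [triple_expand, dotProduct, Fin.sum_univ_three]; ring

/-- A function with positive derivative at a zero `m` changes sign there. -/
lemma exists_sign_of_hasDerivAt_pos {f : ℝ → ℝ} {f' m : ℝ} (hf : HasDerivAt f f' m)
    (hf' : 0 < f') (hm : f m = 0) :
    ∃ δ > 0, (∀ x ∈ Ioo m (m + δ), 0 < f x) ∧ ∀ x ∈ Ioo (m - δ) m, f x < 0 := by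
  have h := (hasDerivAt_iff_tendsto_slope.1 hf).eventually (lt_mem_nhds hf')
  rw [eventually_nhdsWithin_iff, Metric.eventually_nhds_iff] at h
  obtain ⟨δ, hδ, h⟩ := h
  refine ⟨δ, hδ, fun x hx => ?_, fun x hx => ?_⟩
  · have h1 : 0 < slope f m x := h (by rw [Real.dist_eq, abs_lt]; constructor <;> linarith [hx.1, hx.2])
      (by simpa using hx.1.ne')
    rw [slope_def_field, hm, sub_zero] at h1
    exact (div_pos_iff_of_pos_right (by linarith [hx.1])).1 h1
  · have h1 : 0 < slope f m x := h (by rw [Real.dist_eq, abs_lt]; constructor <;> linarith [hx.1, hx.2])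
      (by simpa using hx.2.ne)
    rw [slope_def_field, hm, sub_zero] at h1
    by_contra hc
    exact absurd h1 (not_lt.2 (div_nonpos_of_nonneg_of_nonpos (not_lt.1 hc) (by linarith [hx.2])))

/-- The least nonnegative multiple of `h` that makes `f` nonnegative on a half period. -/
lemma exists_least_multiplier {f h : ℝ → ℝ} {m h' : ℝ} (hfc : Continuous f) (hhc : Continuous h)
    (hf : HasDerivAt f 0 m) (hh : HasDerivAt h h' m) (hh' : 0 < h') (hfm : f m = 0) (hhm : h m = 0)
    (hfa : ∀ x, f (x + Real.pi) = -f x) (hha : ∀ x, h (x + Real.pi) = -h x)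
    (hpos : ∀ x ∈ Ioo m (m + Real.pi), 0 < h x) :
    ∃ l : ℝ, (∀ x ∈ Icc m (m + Real.pi), 0 ≤ f x + l * h x) ∧
      (l = 0 ∨ 0 < l ∧ ∃ t ∈ Ioo m (m + Real.pi), f t + l * h t = 0) := by
  by_cases hall : ∀ x ∈ Icc m (m + Real.pi), 0 ≤ f x
  · exact ⟨0, by simpa using hall, Or.inl rfl⟩
  push Not at hall
  obtain ⟨x₀, hx₀, hneg⟩ := hall
  have hfp : f (m + Real.pi) = 0 := by rw [hfa, hfm, neg_zero]
  have hhp : h (m + Real.pi) = 0 := by rw [hha, hhm, neg_zero]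
  have hx₀' : x₀ ∈ Ioo m (m + Real.pi) := by
    refine ⟨lt_of_le_of_ne hx₀.1 ?_, lt_of_le_of_ne hx₀.2 ?_⟩
    · rintro rfl; linarith
    · rintro rfl; linarith
  have hh0 := hpos x₀ hx₀'
  set μ : ℝ := -f x₀ / h x₀ / 2 with hμ
  have hμpos : 0 < μ := by rw [hμ]; have := div_pos (neg_pos.2 hneg) hh0; linarith
  have hμx : μ * h x₀ = -f x₀ / 2 := by rw [hμ]; field_simp
  have hG : HasDerivAt (fun x => f x + μ * h x) (0 + μ * h') m := hf.add (hh.const_mul μ)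
  obtain ⟨δ, hδ, hr, hl⟩ := exists_sign_of_hasDerivAt_pos hG (by positivity) (by simp [hfm, hhm])
  have hr' : ∀ x ∈ Ioo (m + Real.pi - δ) (m + Real.pi), 0 < f x + μ * h x := by
    intro x hx
    have h1 := hl (x - Real.pi) ⟨by linarith [hx.1], by linarith [hx.2]⟩
    have h2 := hfa (x - Real.pi)
    have h3 := hha (x - Real.pi)
    rw [sub_add_cancel] at h2 h3
    rw [h2, h3]; linarith
  set C : Set ℝ := Icc (m + δ) (m + Real.pi - δ) with hC
  have hCI : C ⊆ Ioo m (m + Real.pi) := fun x hx => ⟨by linarith [hx.1], by linarith [hx.2]⟩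
  have hxC : x₀ ∈ C := by
    constructor
    · by_contra hc
      have := hr x₀ ⟨hx₀'.1, not_le.1 hc⟩
      linarith
    · by_contra hc
      have := hr' x₀ ⟨not_le.1 hc, hx₀'.2⟩
      linarith
  obtain ⟨t, ht, hmin⟩ := isCompact_Icc.exists_isMinOn ⟨x₀, hxC⟩
    (hfc.continuousOn.div hhc.continuousOn (fun x hx => (hpos x (hCI hx)).ne'))
  have hht := hpos t (hCI ht)
  have hle : f t / h t ≤ f x₀ / h x₀ := hmin hxC
  have hlμ : μ < -(f t / h t) := by
    have : μ < -(f x₀ / h x₀) := by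
      rw [hμ, neg_div]; have := div_neg_of_neg_of_pos hneg hh0; linarith
    linarith
  refine ⟨-(f t / h t), fun x hx => ?_, Or.inr ⟨by linarith, t, hCI ht, by field_simp; ring⟩⟩
  rcases eq_or_lt_of_le hx.1 with rfl | hx1
  · simp [hfm, hhm]
  rcases eq_or_lt_of_le hx.2 with rfl | hx2
  · simp [hfp, hhp]
  have hhx := hpos x ⟨hx1, hx2⟩
  by_cases hxC' : x ∈ C
  · have h1 : f t / h t ≤ f x / h x := hmin hxC'
    have h2 : f x / h x * h x = f x := div_mul_cancel₀ _ hhx.ne'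
    nlinarith
  · have h1 : 0 < f x + μ * h x := by
      by_cases h3 : x < m + δ
      · exact hr x ⟨hx1, h3⟩
      · refine hr' x ⟨?_, hx2⟩
        by_contra h4
        exact hxC' ⟨not_lt.1 h3, not_lt.1 h4⟩
    nlinarith

/-- The right end of the maximal interval of zeros of `f` starting at `m`. -/
lemma exists_last_zero_right {f : ℝ → ℝ} (hf : Continuous f) {m b : ℝ} (hmb : m ≤ b)
    (hm : f m = 0) (hb : f b ≠ 0) :
    ∃ k, m ≤ k ∧ k < b ∧ (∀ x ∈ Icc m k, f x = 0) ∧ ∀ ε > 0, ∃ x ∈ Ioo k (k + ε), f x ≠ 0 := by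
  set S : Set ℝ := {y | y ∈ Icc m b ∧ f y ≠ 0} with hS
  have hbS : b ∈ S := ⟨⟨hmb, le_rfl⟩, hb⟩
  have hbdd : BddBelow S := ⟨m, fun y hy => hy.1.1⟩
  have hglb := isGLB_csInf ⟨b, hbS⟩ hbdd
  set k := sInf S
  have hmk : m ≤ k := hglb.2 fun y hy => hy.1.1
  have hkb : k ≤ b := hglb.1 hbS
  have hlt : ∀ x, m ≤ x → x < k → f x = 0 := by
    intro x h1 h2
    by_contra h3
    exact absurd (hglb.1 (show x ∈ S from ⟨⟨h1, by linarith⟩, h3⟩)) (not_le.2 h2)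
  have hk : f k = 0 := by
    rcases eq_or_lt_of_le hmk with h | h
    · rw [← h]; exact hm
    · have hcl : IsClosed {x | f x = 0} := isClosed_eq hf continuous_const
      have : closure (Ioo m k) ⊆ {x | f x = 0} :=
        hcl.closure_subset_iff.2 fun x hx => hlt x hx.1.le hx.2
      rw [closure_Ioo h.ne] at this
      exact this ⟨hmk, le_rfl⟩
  refine ⟨k, hmk, lt_of_le_of_ne hkb (by rintro h; rw [h] at hk; exact hb hk), ?_, ?_⟩
  · intro x hx
    rcases eq_or_lt_of_le hx.2 with h | h
    · rw [h]; exact hk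
    · exact hlt x hx.1 h
  · intro ε hε
    by_contra hc
    push Not at hc
    have : k + ε ≤ k := by
      refine hglb.2 fun y hy => ?_
      by_contra h
      have hky := hglb.1 hy
      rcases eq_or_lt_of_le hky with h1 | h1
      · exact hy.2 (h1 ▸ hk)
      · exact hy.2 (hc y ⟨h1, not_le.1 h⟩)
    linarith

lemma exists_last_zero_left {f : ℝ → ℝ} (hf : Continuous f) {m a : ℝ} (ham : a ≤ m)
    (hm : f m = 0) (ha : f a ≠ 0) :
    ∃ k, k ≤ m ∧ a < k ∧ (∀ x ∈ Icc k m, f x = 0) ∧ ∀ ε > 0, ∃ x ∈ Ioo (k - ε) k, f x ≠ 0 := by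
  obtain ⟨k, h1, h2, h3, h4⟩ := exists_last_zero_right (f := fun x => f (-x)) (by fun_prop)
    (neg_le_neg ham) (by simpa using hm) (by simpa using ha)
  refine ⟨-k, by linarith, by linarith, fun x hx => ?_, fun ε hε => ?_⟩
  · simpa using h3 (-x) ⟨by linarith [hx.2], by linarith [hx.1]⟩
  · obtain ⟨x, hx, hne⟩ := h4 ε hε
    exact ⟨-x, ⟨by linarith [hx.2], by linarith [hx.1]⟩, hne⟩

/-- An antiperiodic curve in `ℝ³`, not contained in a plane, with velocity `d`, having at each
point a transversal plane through the origin that meets it nowhere else up to sign. -/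
structure AntiConvex (c d : ℝ → Fin 3 → ℝ) : Prop where
  hasDerivAt : ∀ t, HasDerivAt c (d t) t
  anti : ∀ t, c (t + Real.pi) = -c t
  unit : ∀ t, c t ⬝ᵥ c t = 1
  transversal : ∀ s, ∃ u : Fin 3 → ℝ, u ⬝ᵥ c s = 0 ∧ 0 < u ⬝ᵥ d s ∧
    ∀ t ∈ Ioo s (s + Real.pi), 0 < u ⬝ᵥ c t
  nonplanar : ∀ v : Fin 3 → ℝ, (∀ t, v ⬝ᵥ c t = 0) → v = 0

/-- The plane spanned by `c a` and `c b` supports the curve on the half period after `a`, and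
does not contain an arc of it starting at `a`. -/
def RightSupport (c : ℝ → Fin 3 → ℝ) (a b : ℝ) : Prop :=
  a < b ∧ b < a + Real.pi ∧ (∀ x ∈ Icc a (a + Real.pi), 0 ≤ triple (c a) (c b) (c x)) ∧
    ∀ ε > 0, ∃ x ∈ Ioo a (a + ε), triple (c a) (c b) (c x) ≠ 0

/-- The plane spanned by `c a` and `c b` supports the curve on the half period after `b`, and
does not contain an arc of it ending at `b`. -/
def LeftSupport (c : ℝ → Fin 3 → ℝ) (a b : ℝ) : Prop :=
  a < b ∧ b < a + Real.pi ∧ (∀ x ∈ Icc b (b + Real.pi), 0 ≤ triple (c a) (c b) (c x)) ∧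
    ∀ ε > 0, ∃ x ∈ Ioo (b - ε) b, triple (c a) (c b) (c x) ≠ 0

/-- The tangent plane at `m` meets the curve, up to sign, only in an arc through `m`, and the
curve lies on its positive side in the half period after that arc. -/
def CleanFlex (c d : ℝ → Fin 3 → ℝ) (m : ℝ) : Prop :=
  ∃ k₁ k₂ : ℝ, k₁ ≤ m ∧ m ≤ k₂ ∧ k₂ < k₁ + Real.pi ∧
    (∀ x ∈ Icc k₁ k₂, triple (c m) (d m) (c x) = 0) ∧
    ∀ x ∈ Ioo k₂ (k₁ + Real.pi), 0 < triple (c m) (d m) (c x)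

namespace AntiConvex

variable {c d : ℝ → Fin 3 → ℝ}

lemma continuous (h : AntiConvex c d) : Continuous c :=
  continuous_iff_continuousAt.2 fun t => (h.hasDerivAt t).continuousAt

lemma continuous_dot (h : AntiConvex c d) (v : Fin 3 → ℝ) : Continuous fun x => v ⬝ᵥ c x :=
  continuous_const.dotProduct h.continuous

lemma hasDerivAt_dot (h : AntiConvex c d) (v : Fin 3 → ℝ) (t : ℝ) :
    HasDerivAt (fun x => v ⬝ᵥ c x) (v ⬝ᵥ d t) t := by
  simp only [dotProduct]
  exact HasDerivAt.fun_sum fun i _ => ((hasDerivAt_pi.1 (h.hasDerivAt t)) i).const_mul (v i)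

lemma dot_anti (h : AntiConvex c d) (v : Fin 3 → ℝ) (t : ℝ) :
    v ⬝ᵥ c (t + Real.pi) = -(v ⬝ᵥ c t) := by
  rw [h.anti, dotProduct_neg]

lemma triple_anti (h : AntiConvex c d) (x y : Fin 3 → ℝ) (t : ℝ) :
    triple x y (c (t + Real.pi)) = -triple x y (c t) := by
  rw [h.anti, triple_neg_right]

lemma triple_add_pi (h : AntiConvex c d) (a b : ℝ) (v : Fin 3 → ℝ) :
    triple (c b) (c (a + Real.pi)) v = triple (c a) (c b) v := by
  rw [h.anti, triple_neg_mid, triple_swap, neg_neg]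

lemma transversal_neg (h : AntiConvex c d) {u : Fin 3 → ℝ} {s : ℝ}
    (hu : ∀ t ∈ Ioo s (s + Real.pi), 0 < u ⬝ᵥ c t) {t : ℝ} (ht : t ∈ Ioo (s - Real.pi) s) :
    u ⬝ᵥ c t < 0 := by
  have := hu (t + Real.pi) ⟨by linarith [ht.1], by linarith [ht.2]⟩
  rw [h.dot_anti] at this
  linarith

lemma triple_change_mid (h : AntiConvex c d) {x y z : ℝ} (hy : y ∈ Ioo x (x + Real.pi))
    (hz : z ∈ Ioo x (x + Real.pi)) (h0 : triple (c x) (c y) (c z) = 0) :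
    ∃ β > 0, ∀ v, triple (c x) (c z) v = β * triple (c x) (c y) v := by
  obtain ⟨u, hu0, -, hu⟩ := h.transversal x
  have h1 := hu y hy
  refine ⟨u ⬝ᵥ c z / u ⬝ᵥ c y, div_pos (hu z hz) h1, fun v => ?_⟩
  have h2 := triple_cramer u (c x) (c y) (c z) v
  rw [h0, hu0, triple_swap_right (c x) (c z) v] at h2
  field_simp
  linarith

lemma triple_change_left (h : AntiConvex c d) {x y z : ℝ} (hx : x ∈ Ioo (y - Real.pi) y)
    (hz : z ∈ Ioo (y - Real.pi) y) (h0 : triple (c x) (c y) (c z) = 0) :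
    ∃ β > 0, ∀ v, triple (c z) (c y) v = β * triple (c x) (c y) v := by
  have h0' : triple (c y) (c (x + Real.pi)) (c (z + Real.pi)) = 0 := by
    rw [h.triple_add_pi, h.triple_anti, h0, neg_zero]
  obtain ⟨β, hβ, h1⟩ := h.triple_change_mid (x := y) (y := x + Real.pi) (z := z + Real.pi)
    ⟨by linarith [hx.1], by linarith [hx.2]⟩ ⟨by linarith [hz.1], by linarith [hz.2]⟩ h0'
  exact ⟨β, hβ, fun v => by simpa only [h.triple_add_pi] using h1 v⟩

/-- A supporting plane is tangent at an interior contact point. -/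
lemma triple_deriv_eq_zero (h : AntiConvex c d) {x y : Fin 3 → ℝ} {l r t : ℝ}
    (ht : t ∈ Ioo l r) (hpos : ∀ z ∈ Icc l r, 0 ≤ triple x y (c z)) (h0 : triple x y (c t) = 0) :
    triple x y (d t) = 0 := by
  refine IsLocalMin.hasDerivAt_eq_zero (f := fun z => triple x y (c z)) (a := t) ?_
    (h.hasDerivAt_dot (x ⨯₃ y) t)
  filter_upwards [Ioo_mem_nhds ht.1 ht.2] with z hz
  rw [h0]
  exact hpos z ⟨hz.1.le, hz.2.le⟩

/-- Coplanar pairs `(a, b)`, `(m, t)` in this cyclic order span the same oriented plane. -/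
lemma triple_change_both (h : AntiConvex c d) {a m b t : ℝ} (ham : a < m) (hmb : m < b)
    (hbt : b ≤ t) (hta : t ≤ a + Real.pi) (hb : b < a + Real.pi)
    (hm0 : triple (c a) (c b) (c m) = 0) (ht0 : triple (c a) (c b) (c t) = 0) :
    ∃ μ > 0, ∀ v, triple (c m) (c t) v = μ * triple (c a) (c b) v := by
  obtain ⟨β, hβ, h1⟩ := h.triple_change_mid ⟨ham.trans hmb, hb⟩ ⟨ham, by linarith⟩ hm0
  have h2 : triple (c m) (c (a + Real.pi)) (c t) = 0 := by
    rw [h.triple_add_pi, h1, ht0, mul_zero]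
  obtain ⟨γ, hγ, h3⟩ := h.triple_change_mid ⟨by linarith, by linarith⟩
    ⟨by linarith, by linarith⟩ h2
  refine ⟨γ * β, mul_pos hγ hβ, fun v => ?_⟩
  rw [h3, h.triple_add_pi, h1, mul_assoc]

lemma not_mem_of_rightSupport (h : AntiConvex c d) {a m b t : ℝ} (hA : RightSupport c a b)
    (ham : a < m) (hmb : m < b) (hS : ∀ x ∈ Icc m (m + Real.pi), 0 ≤ triple (c m) (c t) (c x)) :
    t ∉ Icc b (a + Real.pi) := by
  rintro ⟨hbt, hta⟩
  obtain ⟨-, hb, hpos, hflat⟩ := hA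
  have e1 := hpos m ⟨ham.le, by linarith⟩
  have e2 := hpos t ⟨by linarith, hta⟩
  have e3 := hS b ⟨hmb.le, by linarith⟩
  have e4 := hS (a + Real.pi) ⟨by linarith, by linarith⟩
  rw [h.triple_anti] at e4
  have key : triple (c a) (c b) (c m) = 0 ∧ triple (c a) (c b) (c t) = 0 := by
    rcases eq_or_lt_of_le hbt with rfl | hbt'
    · refine ⟨?_, triple_self_right _ _⟩
      obtain ⟨u, hu0, hu1, -⟩ := h.transversal b
      have d1 := h.triple_deriv_eq_zero (t := b) ⟨ham.trans hmb, hb⟩ hpos (triple_self_right _ _)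
      have d2 := h.triple_deriv_eq_zero (t := b) ⟨hmb, by linarith⟩ hS (triple_self_right _ _)
      have := triple_cramer u (c a) (c b) (d b) (c m)
      rw [d1, d2, hu0] at this
      simp only [mul_zero, zero_mul, zero_add, zero_eq_mul] at this
      exact this.resolve_left hu1.ne'
    rcases eq_or_lt_of_le hta with rfl | hta'
    · rw [h.triple_add_pi, triple_swap_right] at e3
      refine ⟨by linarith, ?_⟩
      rw [h.triple_anti, triple_self_left, neg_zero]
    obtain ⟨u, hu0, -, hu⟩ := h.transversal b
    have u1 := h.transversal_neg hu (t := a) ⟨by linarith, by linarith⟩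
    have u2 := h.transversal_neg hu (t := m) ⟨by linarith, by linarith⟩
    have u3 := hu t ⟨hbt', by linarith⟩
    have := triple_cramer u (c a) (c b) (c t) (c m)
    rw [hu0, triple_swap_right (c m) (c t) (c b)] at this
    have p1 := mul_nonneg (neg_nonneg.2 u2.le) e2
    have p2 := mul_nonneg (neg_nonneg.2 u1.le) e3
    have p3 := mul_nonneg u3.le e1
    constructor
    · have : u ⬝ᵥ c t * triple (c a) (c b) (c m) = 0 := by linarith
      exact (mul_eq_zero.1 this).resolve_left u3.ne'
    · have : u ⬝ᵥ c m * triple (c a) (c b) (c t) = 0 := by linarith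
      exact (mul_eq_zero.1 this).resolve_left u2.ne
  obtain ⟨μ, hμ, hμ'⟩ := h.triple_change_both ham hmb hbt hta hb key.1 key.2
  obtain ⟨x, hx, hne⟩ := hflat (m - a) (by linarith)
  have q1 := hpos x ⟨hx.1.le, by linarith [hx.2]⟩
  have q2 := hS (x + Real.pi) ⟨by linarith [hx.1], by linarith [hx.2]⟩
  rw [h.triple_anti, hμ'] at q2
  have := mul_pos hμ (lt_of_le_of_ne q1 hne.symm)
  linarith

lemma not_mem_of_leftSupport (h : AntiConvex c d) {a m b t : ℝ} (hB : LeftSupport c a b)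
    (ham : a < m) (hmb : m < b) (hS : ∀ x ∈ Icc m (m + Real.pi), 0 ≤ triple (c m) (c t) (c x)) :
    t ∉ Icc b (a + Real.pi) := by
  rintro ⟨hbt, hta⟩
  obtain ⟨-, hb, hpos, hflat⟩ := hB
  have e1 := hpos (m + Real.pi) ⟨by linarith, by linarith⟩
  rw [h.triple_anti] at e1
  have e2 := hpos t ⟨by linarith, by linarith⟩
  have e4 := hS (a + Real.pi) ⟨by linarith, by linarith⟩
  rw [h.triple_anti] at e4
  have key : triple (c a) (c b) (c m) = 0 ∧ triple (c a) (c b) (c t) = 0 := by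
    rcases eq_or_lt_of_le hta with rfl | hta'
    · refine ⟨?_, by rw [h.triple_anti, triple_self_left, neg_zero]⟩
      obtain ⟨u, hu0, hu1, -⟩ := h.transversal (a + Real.pi)
      have d1 := h.triple_deriv_eq_zero (t := a + Real.pi) ⟨hb, by linarith⟩ hpos
        (by rw [h.triple_anti, triple_self_left, neg_zero])
      have d2 := h.triple_deriv_eq_zero (t := a + Real.pi) ⟨by linarith, by linarith⟩ hS
        (triple_self_right _ _)
      rw [h.triple_add_pi] at d2
      have hu0' : u ⬝ᵥ c a = 0 := by rw [h.dot_anti] at hu0; linarith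
      have := triple_cramer u (c a) (c b) (d (a + Real.pi)) (c m)
      rw [d1, d2, hu0'] at this
      simp only [mul_zero, zero_mul, zero_add, zero_eq_mul] at this
      exact this.resolve_left hu1.ne'
    have e4' : triple (c a) (c m) (c t) ≤ 0 := by
      rw [triple_swap, triple_swap_right]; linarith
    rcases eq_or_lt_of_le hbt with rfl | hbt'
    · rw [triple_swap_right] at e4'
      exact ⟨by linarith, triple_self_right _ _⟩
    obtain ⟨u, hu0, -, hu⟩ := h.transversal a
    have u1 := hu b ⟨by linarith, by linarith⟩
    have u2 := hu m ⟨by linarith, by linarith⟩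
    have u3 := hu t ⟨by linarith, hta'⟩
    have := triple_cramer u (c a) (c b) (c t) (c m)
    rw [hu0] at this
    have p1 := mul_nonneg u2.le e2
    have p2 := mul_nonneg u1.le (neg_nonneg.2 e4')
    have p3 := mul_nonneg u3.le e1
    constructor
    · have : u ⬝ᵥ c t * triple (c a) (c b) (c m) = 0 := by linarith
      exact (mul_eq_zero.1 this).resolve_left u3.ne'
    · have : u ⬝ᵥ c m * triple (c a) (c b) (c t) = 0 := by linarith
      exact (mul_eq_zero.1 this).resolve_left u2.ne'
  obtain ⟨μ, hμ, hμ'⟩ := h.triple_change_both ham hmb hbt hta hb key.1 key.2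
  obtain ⟨x, hx, hne⟩ := hflat (b - m) (by linarith)
  have q1 := hpos (x + Real.pi) ⟨by linarith [hx.1], by linarith [hx.2]⟩
  have q2 := hS x ⟨by linarith [hx.1], by linarith [hx.2]⟩
  rw [h.triple_anti] at q1
  rw [hμ'] at q2
  have := mul_pos hμ (lt_of_le_of_ne q1 (neg_ne_zero.2 hne).symm)
  linarith

/-- Each point is a clean flex, or the extremal supporting plane through it touches the curve
again, off its contact arc `[k₁, k₂]`. -/
lemma cleanFlex_or_support (h : AntiConvex c d) (m : ℝ) :
    CleanFlex c d m ∨ ∃ k₁ k₂ t : ℝ, k₁ ≤ m ∧ m ≤ k₂ ∧ k₂ < t ∧ t < k₁ + Real.pi ∧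
      RightSupport c k₂ t ∧ LeftSupport c (t - Real.pi) k₁ ∧
      ∀ x ∈ Icc m (m + Real.pi), 0 ≤ triple (c m) (c t) (c x) := by
  obtain ⟨u, hu0, hu1, hu⟩ := h.transversal m
  obtain ⟨l, hl, hl'⟩ := exists_least_multiplier (f := fun x => (c m ⨯₃ d m) ⬝ᵥ c x)
    (h.continuous_dot _) (h.continuous_dot u)
    (by have := h.hasDerivAt_dot (c m ⨯₃ d m) m
        rwa [show (c m ⨯₃ d m) ⬝ᵥ d m = 0 from triple_self_right _ _] at this)
    (h.hasDerivAt_dot u m) hu1 (triple_self_left _ _) hu0 (h.dot_anti _) (h.dot_anti _) hu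
  set w : Fin 3 → ℝ := c m ⨯₃ d m + l • u with hw
  have hwv : ∀ v, w ⬝ᵥ v = triple (c m) (d m) v + l * u ⬝ᵥ v := by
    intro v; rw [hw, add_dotProduct, smul_dotProduct, triple, smul_eq_mul]
  have hl2 : ∀ x ∈ Icc m (m + Real.pi), 0 ≤ w ⬝ᵥ c x := fun x hx => by
    rw [hwv]; exact hl x hx
  have hwm : w ⬝ᵥ c m = 0 := by rw [hwv, hu0, triple_self_left]; ring
  have hwd : w ⬝ᵥ d m = l * u ⬝ᵥ d m := by rw [hwv, triple_self_right, zero_add]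
  have hw0 : w ≠ 0 := by
    intro h0
    have hl0 : l = 0 := by
      rw [h0, zero_dotProduct] at hwd
      exact (mul_eq_zero.1 hwd.symm).resolve_right hu1.ne'
    have hn : c m ⨯₃ d m = 0 := by rw [hw, hl0, zero_smul, add_zero] at h0; exact h0
    have hid : u ⬝ᵥ d m * (c m ⬝ᵥ c m) - u ⬝ᵥ c m * (c m ⬝ᵥ d m)
        = (c m ⨯₃ d m) ⬝ᵥ (c m ⨯₃ u) := by
      rw [cross_dot_cross, dotProduct_comm (d m) u, dotProduct_comm (d m) (c m),
        dotProduct_comm (c m) u]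
      ring
    rw [hn, zero_dotProduct, h.unit, hu0] at hid
    linarith
  obtain ⟨x₁, hx₁, hx₁'⟩ : ∃ x₁ ∈ Ioo m (m + Real.pi), w ⬝ᵥ c x₁ ≠ 0 := by
    by_contra hc
    push Not at hc
    have hIco : ∀ x ∈ Ico m (m + Real.pi), w ⬝ᵥ c x = 0 := fun x hx => by
      rcases eq_or_lt_of_le hx.1 with rfl | h1
      · exact hwm
      · exact hc x ⟨h1, hx.2⟩
    refine hw0 (h.nonplanar w fun t => ?_)
    have hper : Function.Periodic (fun t => |w ⬝ᵥ c t|) Real.pi := fun t => by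
      simp only [h.dot_anti, abs_neg]
    obtain ⟨y, hy, hy'⟩ := hper.exists_mem_Ico Real.pi_pos t m
    simp only [hIco y hy, abs_zero, abs_eq_zero] at hy'
    exact hy'
  have hwc := h.continuous_dot w
  have hwx₁ : w ⬝ᵥ c (x₁ - Real.pi) ≠ 0 := by
    have := h.dot_anti w (x₁ - Real.pi)
    rw [sub_add_cancel] at this
    intro h0; rw [h0, neg_zero] at this; exact hx₁' this
  obtain ⟨k₂, hmk₂, hk₂x, hz₂, hf₂⟩ := exists_last_zero_right hwc hx₁.1.le hwm hx₁'
  obtain ⟨k₁, hk₁m, hxk₁, hz₁, hf₁⟩ :=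
    exists_last_zero_left hwc (by linarith [hx₁.2] : x₁ - Real.pi ≤ m) hwm hwx₁
  by_cases hex : ∃ t ∈ Ioo k₂ (k₁ + Real.pi), w ⬝ᵥ c t = 0
  · right
    obtain ⟨t, ht, ht0⟩ := hex
    have htm : t ∈ Ioo m (m + Real.pi) := ⟨by linarith [ht.1], by linarith [ht.2]⟩
    have hD : ∀ v, triple (c m) (c t) v = u ⬝ᵥ c t / u ⬝ᵥ d m * w ⬝ᵥ v := by
      intro v
      have h1 := triple_cramer u (c m) (d m) (c t) v
      rw [hwv] at ht0
      rw [hu0, triple_swap_right (c m) (c t) v, show triple (c m) (d m) (c t) = -(l * u ⬝ᵥ c t) by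
        linarith] at h1
      rw [hwv]
      field_simp
      linarith
    have hκ : 0 < u ⬝ᵥ c t / u ⬝ᵥ d m := div_pos (hu t htm) hu1
    have hchange : ∀ k, k₁ ≤ k → k ≤ k₂ → w ⬝ᵥ c k = 0 →
        ∃ β > 0, ∀ v, triple (c k) (c t) v = β * w ⬝ᵥ v := by
      intro k hk1 hk2 hk0
      obtain ⟨β, hβ, hβ'⟩ := h.triple_change_left (x := m) (y := t) (z := k)
        ⟨by linarith [htm.2], htm.1⟩ ⟨by linarith [ht.2], by linarith [ht.1]⟩
        (by rw [hD, hk0, mul_zero])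
      exact ⟨β * (u ⬝ᵥ c t / u ⬝ᵥ d m), mul_pos hβ hκ, fun v => by rw [hβ', hD, mul_assoc]⟩
    refine ⟨k₁, k₂, t, hk₁m, hmk₂, ht.1, ht.2, ⟨ht.1, by linarith [ht.2], ?_⟩,
      ⟨by linarith [ht.2], by linarith [ht.1], ?_⟩, fun x hx => ?_⟩
    · obtain ⟨β, hβ, hβ'⟩ := hchange k₂ (by linarith) le_rfl (hz₂ k₂ ⟨hmk₂, le_rfl⟩)
      refine ⟨fun x hx => ?_, fun ε hε => ?_⟩
      · rw [hβ']
        refine mul_nonneg hβ.le ?_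
        by_cases hxm : x ≤ m + Real.pi
        · exact hl2 x ⟨by linarith [hx.1], hxm⟩
        · have h1 := h.dot_anti w (x - Real.pi)
          rw [sub_add_cancel, hz₂ (x - Real.pi) ⟨by linarith, by linarith [hx.2]⟩] at h1
          rw [h1, neg_zero]
      · obtain ⟨x, hx, hne⟩ := hf₂ ε hε
        exact ⟨x, hx, by rw [hβ']; exact mul_ne_zero hβ.ne' hne⟩
    · obtain ⟨β, hβ, hβ'⟩ := hchange k₁ le_rfl (by linarith) (hz₁ k₁ ⟨le_rfl, hk₁m⟩)
      have hβ'' : ∀ v, triple (c (t - Real.pi)) (c k₁) v = β * w ⬝ᵥ v := fun v => by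
        rw [← h.triple_add_pi, sub_add_cancel, hβ']
      refine ⟨fun x hx => ?_, fun ε hε => ?_⟩
      · rw [hβ'']
        refine mul_nonneg hβ.le ?_
        by_cases hxm : m ≤ x
        · exact hl2 x ⟨hxm, by linarith [hx.2]⟩
        · rw [hz₁ x ⟨hx.1, by linarith⟩]
      · obtain ⟨x, hx, hne⟩ := hf₁ ε hε
        exact ⟨x, hx, by rw [hβ'']; exact mul_ne_zero hβ.ne' hne⟩
    · rw [hD]
      exact mul_nonneg hκ.le (hl2 x hx)
  · left
    push Not at hex
    have hl0 : l = 0 := by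
      refine hl'.resolve_right ?_
      rintro ⟨hlpos, t, ht, ht0⟩
      have ht0' : w ⬝ᵥ c t = 0 := by rw [hwv]; exact ht0
      obtain ⟨δ, hδ, hr, hl3⟩ := exists_sign_of_hasDerivAt_pos (h.hasDerivAt_dot w m)
        (by rw [hwd]; positivity) hwm
      by_cases h1 : t ≤ k₂
      · have hlt : m < min k₂ (m + δ) := lt_min (by linarith [ht.1]) (by linarith)
        obtain ⟨y, hy1, hy2⟩ := exists_between hlt
        have h2 := hr y ⟨hy1, hy2.trans_le (min_le_right _ _)⟩
        rw [hz₂ y ⟨hy1.le, (hy2.trans_le (min_le_left _ _)).le⟩] at h2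
        exact lt_irrefl _ h2
      · have h3 : k₁ + Real.pi ≤ t := by
          by_contra h4
          exact hex t ⟨not_le.1 h1, not_le.1 h4⟩ ht0'
        have hlt : max k₁ (m - δ) < m := max_lt (by linarith [ht.2]) (by linarith)
        obtain ⟨y, hy1, hy2⟩ := exists_between hlt
        have h2 := hl3 y ⟨(le_max_right _ _).trans_lt hy1, hy2⟩
        rw [hz₁ y ⟨((le_max_left _ _).trans_lt hy1).le, hy2.le⟩] at h2
        exact lt_irrefl _ h2
    have hwn : ∀ v, triple (c m) (d m) v = w ⬝ᵥ v := fun v => by rw [hwv, hl0]; ring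
    refine ⟨k₁, k₂, hk₁m, hmk₂, by linarith, fun x hx => ?_, fun x hx => ?_⟩
    · rw [hwn]
      rcases le_total x m with h1 | h1
      · exact hz₁ x ⟨hx.1, h1⟩
      · exact hz₂ x ⟨h1, hx.2⟩
    · rw [hwn]
      exact lt_of_le_of_ne (hl2 x ⟨by linarith [hx.1], by linarith [hx.2]⟩) (hex x hx).symm

/-- Every supporting interval contains a clean flex in its interior. -/
lemma exists_cleanFlex_mem_Ioo (h : AntiConvex c d) {a b : ℝ}
    (hab : RightSupport c a b ∨ LeftSupport c a b) : ∃ p ∈ Ioo a b, CleanFlex c d p := by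
  by_contra hno
  push Not at hno
  have hlt : ∀ {x y : ℝ}, RightSupport c x y ∨ LeftSupport c x y → x < y := by
    rintro x y (h1 | h1) <;> exact h1.1
  have hcross : ∀ {x m y t : ℝ}, RightSupport c x y ∨ LeftSupport c x y → x < m → m < y →
      (∀ z ∈ Icc m (m + Real.pi), 0 ≤ triple (c m) (c t) (c z)) → t < y ∨ x + Real.pi < t := by
    intro x m y t h1 h2 h3 h4
    have h5 : t ∉ Icc y (x + Real.pi) := h1.elim
      (fun h1 => h.not_mem_of_rightSupport h1 h2 h3 h4)
      (fun h1 => h.not_mem_of_leftSupport h1 h2 h3 h4)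
    by_contra hc
    push Not at hc
    exact h5 hc
  let T := {q : ℝ × ℝ // (RightSupport c q.1 q.2 ∨ LeftSupport c q.1 q.2) ∧ a ≤ q.1 ∧ q.2 ≤ b}
  have step : ∀ q : T, ∃ q' : T, q.1.1 < q'.1.1 ∧ q'.1.2 < q.1.2 ∧
      q'.1.2 - q'.1.1 ≤ (q.1.2 - q.1.1) / 2 := by
    rintro ⟨⟨x, y⟩, hJ, hax, hyb⟩
    dsimp only at hJ hax hyb ⊢
    have hxy := hlt hJ
    rcases h.cleanFlex_or_support ((x + y) / 2) with hcl | ⟨k₁, k₂, t, h1, h2, h3, h4, hR, hL, hS⟩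
    · exact absurd hcl (hno _ ⟨by linarith, by linarith⟩)
    · rcases hcross hJ (by linarith) (by linarith) hS with ht | ht
      · exact ⟨⟨(k₂, t), Or.inl hR, by dsimp only; linarith, by dsimp only; linarith⟩,
          by dsimp only; linarith, ht, by dsimp only; linarith⟩
      · exact ⟨⟨(t - Real.pi, k₁), Or.inr hL, by dsimp only; linarith, by dsimp only; linarith⟩,
          by dsimp only; linarith, by dsimp only; linarith, by dsimp only; linarith⟩
  choose next hn1 hn2 hn3 using step
  let q : ℕ → T := fun n => next^[n] ⟨(a, b), hab, le_rfl, le_rfl⟩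
  have hq : ∀ n, q (n + 1) = next (q n) := fun n => Function.iterate_succ_apply' _ _ _
  have hmono : StrictMono fun n => (q n).1.1 := strictMono_nat_of_lt_succ fun n => by
    rw [hq]; exact hn1 _
  have hanti : StrictAnti fun n => (q n).1.2 := strictAnti_nat_of_succ_lt fun n => by
    rw [hq]; exact hn2 _
  have hlen : ∀ n, (q n).1.2 - (q n).1.1 ≤ (b - a) * (1 / 2) ^ n := by
    intro n
    induction n with
    | zero => simp [q]
    | succ n ih =>
      have := hn3 (q n)
      rw [← hq] at this
      rw [pow_succ]
      linarith
  obtain ⟨p, hp⟩ : ∃ p, ∀ n, (q n).1.1 < p ∧ p < (q n).1.2 := by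
    have hle : ∀ i j, (q i).1.1 ≤ (q j).1.2 := fun i j => by
      have h1 := hmono.monotone (le_max_left i j)
      have h2 := hanti.antitone (le_max_right i j)
      have h3 := hlt (q (max i j)).2.1
      linarith
    have hbdd : BddAbove (range fun n => (q n).1.1) := ⟨_, by rintro _ ⟨i, rfl⟩; exact hle i 0⟩
    refine ⟨⨆ n, (q n).1.1, fun n => ⟨?_, ?_⟩⟩
    · exact (hmono n.lt_succ_self).trans_le (le_ciSup hbdd (n + 1))
    · exact (ciSup_le fun i => hle i (n + 1)).trans_lt (hanti n.lt_succ_self)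
  rcases h.cleanFlex_or_support p with hcl | ⟨k₁, k₂, t, h1, h2, h3, h4, -, -, hS⟩
  · exact hno p ⟨(hp 0).1, (hp 0).2⟩ hcl
  · have hpos : 0 < min (t - p) (p + Real.pi - t) := lt_min (by linarith) (by linarith)
    have hlim : Tendsto (fun n : ℕ => (b - a) * (1 / 2 : ℝ) ^ n) atTop (𝓝 0) := by
      simpa using (tendsto_pow_atTop_nhds_zero_of_lt_one (r := (1 / 2 : ℝ)) (by norm_num)
        (by norm_num)).const_mul (b - a)
    obtain ⟨n, hn⟩ := (hlim.eventually (gt_mem_nhds hpos)).exists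
    have h5 := (hlen n).trans_lt hn
    have h6 := h5.trans_le (min_le_left _ _)
    have h7 := h5.trans_le (min_le_right _ _)
    have h8 := hp n
    rcases hcross (q n).2.1 h8.1 h8.2 hS with h9 | h9 <;> linarith

lemma exists_cleanFlex_around (h : AntiConvex c d) {s : ℝ} (hs : ¬CleanFlex c d s) :
    ∃ p q, CleanFlex c d p ∧ CleanFlex c d q ∧ p < s ∧ s < q ∧ q < p + Real.pi := by
  rcases h.cleanFlex_or_support s with hcl | ⟨k₁, k₂, t, h1, h2, h3, h4, hR, hL, -⟩
  · exact absurd hcl hs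
  obtain ⟨p, hp, hp'⟩ := h.exists_cleanFlex_mem_Ioo (Or.inr hL)
  obtain ⟨q, hq, hq'⟩ := h.exists_cleanFlex_mem_Ioo (Or.inl hR)
  exact ⟨p, q, hp', hq', by linarith [hp.2], by linarith [hq.1], by linarith [hp.1, hq.2]⟩

lemma deriv_anti (h : AntiConvex c d) (t : ℝ) : d (t + Real.pi) = -d t := by
  have h1 : HasDerivAt (fun x => c (x + Real.pi)) (d (t + Real.pi)) t :=
    (h.hasDerivAt (t + Real.pi)).comp_add_const t Real.pi
  have h2 : HasDerivAt (fun x => c (x + Real.pi)) (-d t) t := by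
    simpa only [h.anti] using (h.hasDerivAt t).fun_neg
  exact h1.unique h2

lemma not_cleanFlex_add_pi (h : AntiConvex c d) {s : ℝ} (hs : CleanFlex c d s) :
    ¬CleanFlex c d (s + Real.pi) := by
  rintro ⟨j₁, j₂, h1, h2, h3, h4, h5⟩
  obtain ⟨k₁, k₂, g1, g2, g3, g4, g5⟩ := hs
  have hn : ∀ v, triple (c (s + Real.pi)) (d (s + Real.pi)) v = triple (c s) (d s) v := fun v => by
    rw [h.anti, h.deriv_anti, triple_neg_mid, triple_swap, triple_neg_mid, triple_swap]; ring
  have hnonneg : ∀ x ∈ Icc (s + Real.pi) (s + Real.pi + Real.pi),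
      0 ≤ triple (c s) (d s) (c x) := by
    intro x hx
    simp only [hn] at h4 h5
    rcases le_or_gt x j₂ with h6 | h6
    · exact (h4 x ⟨by linarith [hx.1], h6⟩).ge
    · rcases lt_or_ge x (j₁ + Real.pi) with h7 | h7
      · exact (h5 x ⟨h6, h7⟩).le
      · have h8 := h.triple_anti (c s) (d s) (x - Real.pi)
        rw [sub_add_cancel, h4 (x - Real.pi) ⟨by linarith, by linarith [hx.2]⟩] at h8
        rw [h8, neg_zero]
  have h6 := g5 ((k₂ + (k₁ + Real.pi)) / 2) ⟨by linarith, by linarith⟩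
  have h7 := hnonneg ((k₂ + (k₁ + Real.pi)) / 2 + Real.pi) ⟨by linarith, by linarith⟩
  rw [h.triple_anti] at h7
  linarith

lemma exists_three_cleanFlex (h : AntiConvex c d) :
    ∃ p₁ p₂ p₃, CleanFlex c d p₁ ∧ CleanFlex c d p₂ ∧ CleanFlex c d p₃ ∧
      p₁ < p₃ - Real.pi ∧ p₃ - Real.pi < p₂ ∧ p₂ < p₁ + Real.pi := by
  obtain ⟨p₁, hp₁⟩ : ∃ p, CleanFlex c d p := by
    by_cases h0 : CleanFlex c d 0
    · exact ⟨0, h0⟩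
    · obtain ⟨p, -, hp, -⟩ := h.exists_cleanFlex_around h0
      exact ⟨p, hp⟩
  obtain ⟨p₂, p₃, h2, h3, h4, h5, h6⟩ := h.exists_cleanFlex_around (h.not_cleanFlex_add_pi hp₁)
  exact ⟨p₁, p₂, p₃, hp₁, h2, h3, by linarith, by linarith, h4⟩

end AntiConvex

lemma signChange_of_antiperiodic {g : ℝ → ℝ} {σ k₁ k₂ : ℝ} (hσ : σ ≠ 0)
    (hg : ∀ x, g (x + Real.pi) = -g x) (hk : k₁ ≤ k₂) (hk' : k₂ < k₁ + Real.pi)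
    (hz : ∀ x ∈ Icc k₁ k₂, g x = 0) (hp : ∀ x ∈ Ioo k₂ (k₁ + Real.pi), 0 < σ * g x) :
    SignChange g k₁ k₂ := by
  have hn : ∀ x ∈ Ioo (k₂ - Real.pi) k₁, 0 < σ * -g x := fun x hx => by
    rw [← hg]; exact hp _ ⟨by linarith [hx.1], by linarith [hx.2]⟩
  have hπ := Real.pi_pos
  refine ⟨hk, by linarith, hz, k₂ - Real.pi, (k₂ + (k₁ + Real.pi)) / 2, by linarith, by linarith,
    by linarith, fun t ht h0 => ?_, ?_⟩
  · by_contra hc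
    rw [mem_Icc, not_and_or, not_le, not_le] at hc
    rcases hc with h1 | h1
    · have := hn t ⟨ht.1, h1⟩
      simp [h0] at this
    · have := hp t ⟨h1, by linarith [ht.2]⟩
      simp [h0] at this
  · rcases lt_or_gt_of_ne hσ with h1 | h1
    · refine Or.inr ⟨fun t ht => ?_, fun t ht => ?_⟩
      · have := neg_of_mul_pos_right (hn t ht) h1.le
        linarith
      · exact neg_of_mul_pos_right (hp t ⟨ht.1, by linarith [ht.2]⟩) h1.le
    · refine Or.inl ⟨fun t ht => ?_, fun t ht => ?_⟩
      · have := pos_of_mul_pos_right (hn t ht) h1.le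
        linarith
      · exact pos_of_mul_pos_right (hp t ⟨ht.1, by linarith [ht.2]⟩) h1.le

lemma twoCleanCrossings_of_antiperiodic {g : ℝ → ℝ} {σ s k₁ k₂ : ℝ} (hσ : σ ≠ 0)
    (hg : ∀ x, g (x + Real.pi) = -g x) (hs : k₁ ≤ s) (hs' : s ≤ k₂) (hk' : k₂ < k₁ + Real.pi)
    (hz : ∀ x ∈ Icc k₁ k₂, g x = 0) (hp : ∀ x ∈ Ioo k₂ (k₁ + Real.pi), 0 < σ * g x) :
    TwoCleanCrossings g s := by
  have hg' : ∀ x, g (x - Real.pi) = -g x := fun x => by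
    have := hg (x - Real.pi); rw [sub_add_cancel] at this; linarith
  refine ⟨k₁, k₂, hs, hs', signChange_of_antiperiodic hσ hg (hs.trans hs') hk' hz hp,
    signChange_of_antiperiodic (neg_ne_zero.2 hσ) hg (by linarith) (by linarith)
      (fun x hx => ?_) (fun x hx => ?_), fun z hz0 hout => ?_⟩
  · have := hz (x - Real.pi) ⟨by linarith [hx.1], by linarith [hx.2]⟩
    rw [hg'] at this; linarith
  · have := hp (x - Real.pi) ⟨by linarith [hx.1], by linarith [hx.2]⟩
    rw [hg'] at this; linarith
  · exfalso
    obtain ⟨n, hn, -⟩ := existsUnique_add_zsmul_mem_Ico Real.pi_pos z k₁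
    have hper : Function.Periodic (fun t => |g t|) Real.pi := fun t => by simp only [hg, abs_neg]
    have h0 : g (z + n • Real.pi) = 0 := by
      have := hper.zsmul n z
      simpa [hz0] using this
    have hK : z + n • Real.pi ≤ k₂ := by
      by_contra hc
      have := hp _ ⟨not_le.1 hc, hn.2⟩
      rw [h0, mul_zero] at this
      exact lt_irrefl _ this
    rw [zsmul_eq_mul] at hn hK
    rcases Int.even_or_odd' n with ⟨j, rfl | rfl⟩
    · refine (hout j).1 ?_
      push_cast at hn hK
      constructor <;> linarith [hn.1]
    · refine (hout (j + 1)).2 ?_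
      push_cast at hn hK ⊢
      constructor <;> linarith [hn.1]

namespace AntiConvex

variable {c d : ℝ → Fin 3 → ℝ}

lemma twoCleanCrossings (h : AntiConvex c d) {p s : ℝ} (hp : CleanFlex c d p)
    (hs : s = p ∨ s = p - Real.pi) {v : Fin 3 → ℝ} (hv : v ⬝ᵥ v = 1) (hvc : v ⬝ᵥ c s = 0)
    (hvd : v ⬝ᵥ d s = 0) : TwoCleanCrossings (fun t => v ⬝ᵥ c t) s := by
  have hvp : v ⬝ᵥ c p = 0 ∧ v ⬝ᵥ d p = 0 := by
    rcases hs with rfl | rfl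
    · exact ⟨hvc, hvd⟩
    · have h1 := h.anti (p - Real.pi)
      have h2 := h.deriv_anti (p - Real.pi)
      rw [sub_add_cancel] at h1 h2
      rw [h1, h2, dotProduct_neg, dotProduct_neg, hvc, hvd]
      simp
  obtain ⟨k₁, k₂, h1, h2, h3, h4, h5⟩ := hp
  have hn : ∀ x, triple (c p) (d p) x = triple (c p) (d p) v * (v ⬝ᵥ x) := by
    intro x
    have := triple_cramer v (c p) (d p) v x
    rw [hvp.1, hvp.2, hv] at this
    linarith
  have hσ : triple (c p) (d p) v ≠ 0 := by
    intro h0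
    have := h5 ((k₂ + (k₁ + Real.pi)) / 2) ⟨by linarith, by linarith⟩
    rw [hn, h0, zero_mul] at this
    exact lt_irrefl _ this
  have h4' : ∀ x ∈ Icc k₁ k₂, v ⬝ᵥ c x = 0 := fun x hx => by
    have := h4 x hx
    rw [hn] at this
    exact (mul_eq_zero.1 this).resolve_left hσ
  have h5' : ∀ x ∈ Ioo k₂ (k₁ + Real.pi), 0 < triple (c p) (d p) v * (v ⬝ᵥ c x) := fun x hx => by
    rw [← hn]; exact h5 x hx
  rcases hs with rfl | rfl
  · exact twoCleanCrossings_of_antiperiodic hσ (h.dot_anti v) h1 h2 h3 h4' h5'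
  · refine twoCleanCrossings_of_antiperiodic (k₁ := k₁ - Real.pi) (k₂ := k₂ - Real.pi)
      (neg_ne_zero.2 hσ) (h.dot_anti v) (by linarith) (by linarith) (by linarith)
      (fun x hx => ?_) (fun x hx => ?_)
    · have := h4' (x + Real.pi) ⟨by linarith [hx.1], by linarith [hx.2]⟩
      rw [h.dot_anti] at this
      linarith
    · have := h5' (x + Real.pi) ⟨by linarith [hx.1], by linarith [hx.2]⟩
      rw [h.dot_anti] at this
      linarith

/-- The defining property of anti-convexity, with transversal planes not yet oriented, yields
`AntiConvex`. -/
lemma of_transversal {c : ℝ → Fin 3 → ℝ} (hd : Differentiable ℝ c)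
    (hunit : ∀ t, c t ⬝ᵥ c t = 1) (hap : ∀ t, c (t + Real.pi) = -c t)
    (hsimple : ∀ s t : ℝ, c s = c t → ∃ n : ℤ, t - s = 2 * Real.pi * n)
    (hngc : ¬∃ v : Fin 3 → ℝ, v ≠ 0 ∧ ∀ t, v ⬝ᵥ c t = 0)
    (hac : ∀ s : ℝ, ∃ w : Fin 3 → ℝ, w ⬝ᵥ c s = 0 ∧ w ⬝ᵥ deriv c s ≠ 0 ∧
      ∀ t : ℝ, c t ≠ c s → c t ≠ -c s → w ⬝ᵥ c t ≠ 0) : AntiConvex c (deriv c) := by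
  have hπ := Real.pi_pos
  refine ⟨fun t => (hd t).hasDerivAt, hap, hunit, fun s => ?_, fun v hv => ?_⟩
  swap
  · by_contra h0
    exact hngc ⟨v, h0, hv⟩
  obtain ⟨w, hw0, hwd, hw⟩ := hac s
  have hgap : ∀ (y : ℝ) (n : ℤ), -(2 * Real.pi) < y → y < 0 → y ≠ 2 * Real.pi * n := by
    intro y n h1 h2 h3
    have h4 : (-1 : ℝ) < n := by nlinarith
    have h5 : (n : ℝ) < 0 := by nlinarith
    have h6 : -1 < n := by exact_mod_cast h4
    have h7 : n < 0 := by exact_mod_cast h5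
    omega
  have hne : ∀ t ∈ Ioo s (s + Real.pi), w ⬝ᵥ c t ≠ 0 := by
    intro t ht
    refine hw t (fun h1 => ?_) (fun h1 => ?_)
    · obtain ⟨n, hn⟩ := hsimple _ _ h1
      exact hgap _ n (by linarith [ht.2]) (by linarith [ht.1]) hn
    · rw [← hap] at h1
      obtain ⟨n, hn⟩ := hsimple _ _ h1.symm
      exact hgap _ n (by linarith [ht.1]) (by linarith [ht.2]) hn
  obtain ⟨u, hu0, hud, hu⟩ : ∃ u : Fin 3 → ℝ, u ⬝ᵥ c s = 0 ∧ 0 < u ⬝ᵥ deriv c s ∧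
      ∀ t ∈ Ioo s (s + Real.pi), u ⬝ᵥ c t ≠ 0 := by
    rcases lt_or_gt_of_ne hwd with h1 | h1
    · exact ⟨-w, by simp [hw0], by simpa using h1, fun t ht => by simpa using hne t ht⟩
    · exact ⟨w, hw0, h1, hne⟩
  refine ⟨u, hu0, hud, fun t ht => ?_⟩
  have hderiv : HasDerivAt (fun x => u ⬝ᵥ c x) (u ⬝ᵥ deriv c s) s := by
    simp only [dotProduct]
    exact HasDerivAt.fun_sum fun i _ => ((hasDerivAt_pi.1 (hd s).hasDerivAt) i).const_mul (u i)
  have hcont : Continuous fun x => u ⬝ᵥ c x := continuous_const.dotProduct hd.continuous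
  obtain ⟨δ, hδ, hr, -⟩ := exists_sign_of_hasDerivAt_pos hderiv hud hu0
  obtain ⟨y, hy1, hy2⟩ := exists_between (lt_min ht.1 (by linarith : s < s + δ))
  have hy3 := hr y ⟨hy1, hy2.trans_le (min_le_right _ _)⟩
  have hyt := (hy2.trans_le (min_le_left _ _)).le
  by_contra hc
  obtain ⟨z, hz, hz0⟩ := intermediate_value_Icc' hyt hcont.continuousOn ⟨not_lt.1 hc, hy3.le⟩
  exact hu z ⟨by linarith [hz.1], by linarith [hz.2, ht.2]⟩ hz0

end AntiConvex

/-- **Theorem B** (in terms of the lift `γ̂ : ℝ/2πℤ → S² ⊂ ℝ³` of an anti-convex curve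
`γ` in `P²`): there exist `s₁ < s₂ < s₃ < s₁ + π` such that at each `sᵢ` the function
`g(t) = ⟨v, γ̂(t)⟩`, where `v` is the unit normal of the tangent great circle of `γ̂` at
`γ̂(sᵢ)`, changes sign at exactly two connected components of its zero set in `ℝ/2πℤ`,
namely those containing `sᵢ` and `sᵢ + π`.  (Equivalently: `γ` has at least three
inflection points whose tangent lines cross `γ` only once.) -/
theorem three_inflections_tangents_cross_once
    (c : ℝ → (Fin 3 → ℝ))
    (hsm : ContDiff ℝ 2 c)
    (hunit : ∀ t, c t ⬝ᵥ c t = 1)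
    (hap : ∀ t, c (t + Real.pi) = - c t)
    (hreg : ∀ t, deriv c t ≠ 0)
    (hsimple : ∀ s t : ℝ, c s = c t → ∃ n : ℤ, t - s = 2 * Real.pi * n)
    (hngc : ¬ ∃ v : Fin 3 → ℝ, v ≠ 0 ∧ ∀ t, v ⬝ᵥ c t = 0)
    (hac : ∀ s : ℝ, ∃ w : Fin 3 → ℝ, w ⬝ᵥ c s = 0 ∧ w ⬝ᵥ deriv c s ≠ 0 ∧
      ∀ t : ℝ, c t ≠ c s → c t ≠ - c s → w ⬝ᵥ c t ≠ 0) :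
    ∃ s₁ s₂ s₃ : ℝ, s₁ < s₂ ∧ s₂ < s₃ ∧ s₃ < s₁ + Real.pi ∧
      ∀ s ∈ ({s₁, s₂, s₃} : Set ℝ), ∀ v : Fin 3 → ℝ,
        v ⬝ᵥ v = 1 → v ⬝ᵥ c s = 0 → v ⬝ᵥ deriv c s = 0 →
        TwoCleanCrossings (fun t => v ⬝ᵥ c t) s := by
  have h := AntiConvex.of_transversal (hsm.differentiable (by norm_num)) hunit hap hsimple hngc hac
  obtain ⟨p₁, p₂, p₃, h1, h2, h3, h4, h5, h6⟩ := h.exists_three_cleanFlex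
  refine ⟨p₁, p₃ - Real.pi, p₂, h4, h5, h6, ?_⟩
  rintro s hs v hv hvc hvd
  simp only [mem_insert_iff, mem_singleton_iff] at hs
  rcases hs with rfl | hs | rfl
  · exact h.twoCleanCrossings h1 (Or.inl rfl) hv hvc hvd
  · exact h.twoCleanCrossings h3 (Or.inr hs) hv hvc hvd
  · exact h.twoCleanCrossings h2 (Or.inl rfl) hv hvc hvd

end
end

section
/- Let f : ℝ → ℝ be a π-antiperiodic C¹ function not belonging to 𝒜₂, and suppose that for every ψ ∈ 𝒜₂ the zero set of f − ψ is discrete. Then there exist t₁ < t₂ < t₃ < t₁ + π such that each tᵢ is a clean flex of f of order 2, the functions f − φ_{t₁} and f − φ_{t₃} change sign from negative to positive at t₁ and t₃ respectively, and f − φ_{t₂} changes sign from positive to negative at t₂. -/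
open Set Filter Topology

noncomputable section

/-- `𝒜₂`: the two-dimensional space of functions `t ↦ a cos t + b sin t`. -/
def A2 : Set (ℝ → ℝ) :=
  {g | ∃ a b : ℝ, g = fun t => a * Real.cos t + b * Real.sin t}

/-- `f` is `π`-antiperiodic: `f(t+π) = -f(t)` for all `t`. -/
def AntiPer (f : ℝ → ℝ) : Prop := ∀ t : ℝ, f (t + Real.pi) = - f t

/-- For every `ψ ∈ 𝒜₂` the zero set of `f - ψ` is discrete: every zero is isolated. -/
def DiscreteZeros (f : ℝ → ℝ) : Prop :=
  ∀ ψ ∈ A2, ∀ x : ℝ, f x = ψ x → ∃ ε > 0, ∀ y : ℝ, |y - x| < ε → f y = ψ y → y = x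

/-- `ψ` is the *limiting function* of `f` at `p`: `ψ ∈ 𝒜₂`, `ψ(p) = f(p)`, and
(a) `ψ ≥ f` on `(p, p+π)`; (b) `ψ ≤ f` on `(p-π, p)`; (c) if `ψ` is not the
osculating function of `f` at `p` (i.e. `ψ′(p) ≠ f′(p)`), then `ψ(q) = f(q)`
for some `q ∈ (p, p+π)`. -/
def IsLimiting (f ψ : ℝ → ℝ) (p : ℝ) : Prop :=
  ψ ∈ A2 ∧ ψ p = f p ∧
  (∀ t ∈ Ioo p (p + Real.pi), f t ≤ ψ t) ∧
  (∀ t ∈ Ioo (p - Real.pi) p, ψ t ≤ f t) ∧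
  (deriv ψ p ≠ deriv f p → ∃ q ∈ Ioo p (p + Real.pi), ψ q = f q)

/-- `p` is a *clean flex of order 2* of `f`: the zero set of `f - φ_p` (with `φ_p` the
osculating function of `f` at `p`), regarded as a subset of `ℝ/πℤ`, is connected. -/
def CleanFlex2 (f : ℝ → ℝ) (p : ℝ) : Prop :=
  ∀ φ ∈ A2, φ p = f p → deriv φ p = deriv f p →
    IsConnected (((↑·) : ℝ → AddCircle Real.pi) '' {t : ℝ | f t = φ t})

/-- `g` changes sign from negative to positive at the isolated zero `t₀`. -/
def NegToPos (g : ℝ → ℝ) (t₀ : ℝ) : Prop :=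
  ∃ ε > 0, (∀ x ∈ Ioo (t₀ - ε) t₀, g x < 0) ∧ (∀ x ∈ Ioo t₀ (t₀ + ε), 0 < g x)

/-- `g` changes sign from positive to negative at the isolated zero `t₀`. -/
def PosToNeg (g : ℝ → ℝ) (t₀ : ℝ) : Prop :=
  ∃ ε > 0, (∀ x ∈ Ioo (t₀ - ε) t₀, 0 < g x) ∧ (∀ x ∈ Ioo t₀ (t₀ + ε), g x < 0)

/-- The osculating function of `f` at `p`. -/
def osculating (f : ℝ → ℝ) (p : ℝ) : ℝ → ℝ :=
  fun t => f p * Real.cos (t - p) + deriv f p * Real.sin (t - p)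

/-- `ψ ∈ 𝒜₂` agrees with `f` at `p`, bounds `f` from above on `[p, p+π]` and from below on
`[p-π, p]`. -/
structure IsUpper (f ψ : ℝ → ℝ) (p : ℝ) : Prop where
  mem : ψ ∈ A2
  eq : f p = ψ p
  le : ∀ t ∈ Icc p (p + Real.pi), f t ≤ ψ t
  ge : ∀ t ∈ Icc (p - Real.pi) p, ψ t ≤ f t

/-- `f` lies strictly below its osculating function at `p` on `(p, p+π)`. -/
def IsNegFlex (f : ℝ → ℝ) (p : ℝ) : Prop :=
  ∀ t ∈ Ioo p (p + Real.pi), f t < osculating f p t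

/-- Some upper line of `f` at `x` meets the graph of `f` at the further point `y`. -/
def IsChord (f : ℝ → ℝ) (x y : ℝ) : Prop :=
  y ≠ x ∧ |y - x| < Real.pi ∧ ∃ ψ, IsUpper f ψ x ∧ f y = ψ y

lemma A2.antiPer {g : ℝ → ℝ} (hg : g ∈ A2) : AntiPer g := by
  obtain ⟨a, b, rfl⟩ := hg
  intro t
  simp only [Real.cos_add_pi, Real.sin_add_pi]
  ring

lemma AntiPer.sub_pi {g : ℝ → ℝ} (hg : AntiPer g) (t : ℝ) : g (t - Real.pi) = -g t := by
  have := hg (t - Real.pi)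
  rw [sub_add_cancel] at this
  linarith

lemma A2.sub_mem {g h : ℝ → ℝ} (hg : g ∈ A2) (hh : h ∈ A2) : (fun t => g t - h t) ∈ A2 := by
  obtain ⟨a, b, rfl⟩ := hg
  obtain ⟨c, d, rfl⟩ := hh
  exact ⟨a - c, b - d, by funext t; ring⟩

lemma A2.three_point {d : ℝ → ℝ} (hd : d ∈ A2) (x y z : ℝ) :
    d x * Real.sin (z - y) + d z * Real.sin (y - x) = d y * Real.sin (z - x) := by
  obtain ⟨a, b, rfl⟩ := hd
  simp only [Real.sin_sub]
  ring

lemma A2.eq_zero {d : ℝ → ℝ} (hd : d ∈ A2) {x z : ℝ} (hxz : Real.sin (z - x) ≠ 0)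
    (hx : d x = 0) (hz : d z = 0) (y : ℝ) : d y = 0 := by
  have := A2.three_point hd x y z
  rw [hx, hz] at this
  simpa [hxz] using this.symm

/-- A member of `𝒜₂` nonnegative at `x` and `z` and nonpositive in between vanishes. -/
lemma A2.eq_zero_of_signs {d : ℝ → ℝ} (hd : d ∈ A2) {x y z : ℝ} (hxy : x < y) (hyz : y < z)
    (hzx : z < x + Real.pi) (hx : 0 ≤ d x) (hy : d y ≤ 0) (hz : 0 ≤ d z) (t : ℝ) : d t = 0 := by
  have h1 : 0 < Real.sin (z - y) := Real.sin_pos_of_pos_of_lt_pi (by linarith) (by linarith)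
  have h2 : 0 < Real.sin (y - x) := Real.sin_pos_of_pos_of_lt_pi (by linarith) (by linarith)
  have h3 : 0 < Real.sin (z - x) := Real.sin_pos_of_pos_of_lt_pi (by linarith) (by linarith)
  have h := A2.three_point hd x y z
  have e1 := mul_nonneg hx h1.le
  have e2 := mul_nonneg hz h2.le
  have e3 := mul_nonpos_of_nonpos_of_nonneg hy h3.le
  have f1 : d x * Real.sin (z - y) = 0 := by linarith
  have f2 : d z * Real.sin (y - x) = 0 := by linarith
  exact A2.eq_zero hd h3.ne' ((mul_eq_zero.1 f1).resolve_right h1.ne')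
    ((mul_eq_zero.1 f2).resolve_right h2.ne') t

lemma A2.of_shift (p a b : ℝ) :
    (fun t => a * Real.cos (t - p) + b * Real.sin (t - p)) ∈ A2 := by
  refine ⟨a * Real.cos p - b * Real.sin p, a * Real.sin p + b * Real.cos p, ?_⟩
  funext t
  rw [Real.cos_sub, Real.sin_sub]
  ring

lemma osculating_mem (f : ℝ → ℝ) (p : ℝ) : osculating f p ∈ A2 := A2.of_shift _ _ _

lemma A2.differentiable {g : ℝ → ℝ} (hg : g ∈ A2) : Differentiable ℝ g := by
  obtain ⟨a, b, rfl⟩ := hg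
  fun_prop

lemma A2.eq_osculating {f φ : ℝ → ℝ} {p : ℝ} (hφ : φ ∈ A2) (h0 : φ p = f p)
    (h1 : deriv φ p = deriv f p) : φ = osculating f p := by
  obtain ⟨a, b, rfl⟩ := hφ
  have hd : HasDerivAt (fun t => a * Real.cos t + b * Real.sin t)
      (a * -Real.sin p + b * Real.cos p) p :=
    ((Real.hasDerivAt_cos p).const_mul a).add ((Real.hasDerivAt_sin p).const_mul b)
  rw [hd.deriv] at h1
  funext t
  simp only [osculating, ← h0, ← h1]
  have e : t = p + (t - p) := by ring
  conv_lhs => rw [e, Real.cos_add, Real.sin_add]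
  ring

lemma DiscreteZeros.not_eq_on {f ψ : ℝ → ℝ} (hdisc : DiscreteZeros f) (hψ : ψ ∈ A2) {a b : ℝ}
    (hab : a < b) (h : ∀ t ∈ Ioo a b, f t = ψ t) : False := by
  obtain ⟨ε, hε, H⟩ := hdisc ψ hψ ((a + b) / 2) (h _ ⟨by linarith, by linarith⟩)
  have hm : 0 < min (ε / 2) ((b - a) / 4) := by
    apply lt_min <;> linarith
  have h1 := min_le_left (ε / 2) ((b - a) / 4)
  have h2 := min_le_right (ε / 2) ((b - a) / 4)
  have := H ((a + b) / 2 + min (ε / 2) ((b - a) / 4))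
    (by rw [add_sub_cancel_left, abs_of_pos hm]; linarith)
    (h _ ⟨by linarith, by linarith⟩)
  linarith

lemma IsUpper.false_of_lt {f ψ : ℝ → ℝ} (hdisc : DiscreteZeros f) {p r : ℝ}
    (hp : IsUpper f ψ p) (hr : IsUpper f ψ r) (hpr : p < r) (hrp : r < p + Real.pi) : False :=
  hdisc.not_eq_on hp.mem hpr fun t ht =>
    le_antisymm (hp.le t ⟨ht.1.le, by linarith [ht.2]⟩) (hr.ge t ⟨by linarith [ht.1], ht.2.le⟩)

/-- Touching points of an upper line are points of tangency. -/
lemma IsUpper.eq_osculating {f ψ : ℝ → ℝ} (hf : Differentiable ℝ f) {p q : ℝ}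
    (hp : IsUpper f ψ p) (hne : q ≠ p) (hlt : |q - p| < Real.pi) (hq : f q = ψ q) :
    ψ = osculating f q := by
  have hψ := A2.differentiable hp.mem
  refine A2.eq_osculating hp.mem hq.symm ?_
  rw [abs_lt] at hlt
  have hext : IsLocalExtr (fun t => f t - ψ t) q := by
    rcases lt_or_gt_of_ne hne with h | h
    · left
      filter_upwards [Ioo_mem_nhds (show p - Real.pi < q by linarith) h] with t ht
      have := hp.ge t ⟨ht.1.le, ht.2.le⟩
      linarith
    · right
      filter_upwards [Ioo_mem_nhds h (show q < p + Real.pi by linarith)] with t ht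
      have := hp.le t ⟨ht.1.le, ht.2.le⟩
      linarith
  have h0 := hext.deriv_eq_zero
  rw [deriv_fun_sub (hf q) (hψ q)] at h0
  linarith

/-- An upper line crossing between the ends of a chord has all its contacts, modulo `π`,
within the chord. -/
lemma IsChord.exists_contact {f ψ : ℝ → ℝ} (hap : AntiPer f) (hdisc : DiscreteZeros f)
    {x y r q : ℝ} (hc : IsChord f x y) (hr : r ∈ Ioo (min x y) (max x y)) (hu : IsUpper f ψ r)
    (hne : q ≠ r) (hlt : |q - r| < Real.pi) (hq : f q = ψ q) :
    ∃ q' ∈ Icc (min x y) (max x y), q' ≠ r ∧ |q' - r| < Real.pi ∧ f q' = ψ q' := by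
  obtain ⟨hyx, hlen, χ, hχ, hy⟩ := hc
  rw [abs_lt] at hlen hlt
  have hψap := A2.antiPer hu.mem
  have hqp : f (q + Real.pi) = ψ (q + Real.pi) := by rw [hap, hψap, hq]
  have hqm : f (q - Real.pi) = ψ (q - Real.pi) := by rw [hap.sub_pi, hψap.sub_pi, hq]
  rcases lt_or_gt_of_ne hyx with h | h
  · rw [min_eq_right h.le, max_eq_left h.le] at *
    obtain ⟨hr1, hr2⟩ := hr
    have key : ∀ t, x - Real.pi < t → t < y → r - Real.pi < t → f t = ψ t → False := by
      intro t h1 h2 h3 ht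
      have hz := A2.eq_zero_of_signs (A2.sub_mem hu.mem hχ.mem) h2 hr1 (by linarith)
        (by have := hχ.ge t ⟨h1.le, by linarith⟩; linarith)
        (by have := hu.ge y ⟨by linarith, hr1.le⟩; linarith)
        (by have := hχ.ge r ⟨by linarith, hr2.le⟩; have := hu.eq; linarith)
      have : ψ = χ := funext fun s => by have := hz s; linarith
      subst this
      exact hu.false_of_lt hdisc hχ hr2 (by linarith)
    by_cases c1 : q < y
    · by_cases c2 : x - Real.pi < q
      · exact (key q c2 c1 (by linarith) hq).elim
      · exact ⟨q + Real.pi, ⟨by linarith, by linarith⟩, by linarith [hr2],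
          by rw [abs_lt]; constructor <;> linarith, hqp⟩
    · by_cases c2 : q ≤ x
      · exact ⟨q, ⟨by linarith, c2⟩, hne, abs_lt.2 hlt, hq⟩
      · push Not at c1 c2
        have h3 : ¬ (q - Real.pi < y) := fun h3 => key _ (by linarith) h3 (by linarith) hqm
        exact ⟨q - Real.pi, ⟨by linarith, by linarith⟩, by intro h; linarith,
          by rw [abs_lt]; constructor <;> linarith, hqm⟩
  · rw [min_eq_left h.le, max_eq_right h.le] at *
    obtain ⟨hr1, hr2⟩ := hr
    have key : ∀ t, y < t → t < x + Real.pi → t < r + Real.pi → f t = ψ t → False := by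
      intro t h1 h2 h3 ht
      have hz := A2.eq_zero_of_signs (A2.sub_mem hχ.mem hu.mem) hr2 h1 (by linarith)
        (by have := hχ.le r ⟨hr1.le, by linarith⟩; have := hu.eq; linarith)
        (by have := hu.le y ⟨hr2.le, by linarith⟩; linarith)
        (by have := hχ.le t ⟨by linarith, h2.le⟩; linarith)
      have : ψ = χ := funext fun s => by have := hz s; linarith
      subst this
      exact hχ.false_of_lt hdisc hu hr1 (by linarith)
    by_cases c1 : y < q
    · by_cases c2 : q < x + Real.pi
      · exact (key q c1 c2 (by linarith) hq).elim
      · exact ⟨q - Real.pi, ⟨by linarith, by linarith⟩, by linarith,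
          by rw [abs_lt]; constructor <;> linarith, hqm⟩
    · by_cases c2 : x ≤ q
      · exact ⟨q, ⟨c2, by linarith⟩, hne, abs_lt.2 hlt, hq⟩
      · push Not at c1 c2
        have h3 : ¬ (y < q + Real.pi) := fun h3 => key _ h3 (by linarith) (by linarith) hqp
        exact ⟨q + Real.pi, ⟨by linarith, by linarith⟩, by intro h; linarith,
          by rw [abs_lt]; constructor <;> linarith, hqp⟩

/-- The upper line at `p` exists and touches the graph, unless `p` is a flex. -/
lemma isNegFlex_or_isChord {f : ℝ → ℝ} (hf : Differentiable ℝ f) (hap : AntiPer f) (p : ℝ) :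
    IsNegFlex f p ∨ ∃ q, IsChord f p q := by
  have hpi := Real.pi_pos
  set f₁ : ℝ → ℝ := fun t => f t - f p * Real.cos (t - p) with hf₁
  have hd₁ : HasDerivAt f₁ (deriv f p) p := by
    have h1 : HasDerivAt (fun t => Real.cos (t - p)) (-Real.sin (p - p)) p :=
      (Real.hasDerivAt_cos (p - p)).comp_sub_const p p
    have := (hf p).hasDerivAt.fun_sub (h1.const_mul (f p))
    simpa using this
  have hf₁p : f₁ p = 0 := by simp [hf₁]
  set h : ℝ → ℝ := fun t => dslope f₁ p t / Real.sinc (t - p) with hh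
  have hsinc : ∀ t ∈ Icc (p - Real.pi / 2) (p + Real.pi / 2), 0 < Real.sinc (t - p) := by
    intro t ht
    by_cases htp : t = p
    · simp [htp]
    have htp' : t - p ≠ 0 := sub_ne_zero.2 htp
    rw [Real.sinc_of_ne_zero htp']
    rcases lt_or_gt_of_ne htp' with h | h
    · exact div_pos_of_neg_of_neg (Real.sin_neg_of_neg_of_neg_pi_lt h (by linarith [ht.1])) h
    · exact div_pos (Real.sin_pos_of_pos_of_lt_pi h (by linarith [ht.2])) h
  have hcont : ContinuousOn h (Icc (p - Real.pi / 2) (p + Real.pi / 2)) := by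
    refine ContinuousOn.div ?_ ?_ fun t ht => (hsinc t ht).ne'
    · have : ContinuousOn (dslope f₁ p) univ :=
        (continuousOn_dslope univ_mem).2
          ⟨by have := hf.continuous; fun_prop, hd₁.differentiableAt⟩
      exact this.mono (subset_univ _)
    · exact (Real.continuous_sinc.comp (continuous_id.sub continuous_const)).continuousOn
  have hmul : ∀ t ∈ Icc (p - Real.pi / 2) (p + Real.pi / 2), f₁ t = h t * Real.sin (t - p) := by
    intro t ht
    by_cases htp : t = p
    · simp [htp, hf₁p]
    have htp' : t - p ≠ 0 := sub_ne_zero.2 htp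
    have hs := (hsinc t ht).ne'
    have hs' : Real.sin (t - p) = Real.sinc (t - p) * (t - p) := by
      rw [Real.sinc_of_ne_zero htp']; field_simp
    simp only [hh]
    rw [dslope_of_ne _ htp, slope_def_field, hf₁p, hs']
    field_simp
    ring
  have hhp : h p = deriv f p := by
    simp [hh, hd₁.deriv]
  obtain ⟨q, hq, hmax⟩ := isCompact_Icc.exists_isMaxOn
    (nonempty_Icc.2 (by linarith : p - Real.pi / 2 ≤ p + Real.pi / 2)) hcont
  set ψ : ℝ → ℝ := fun t => f p * Real.cos (t - p) + h q * Real.sin (t - p) with hψ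
  have hψm : ψ ∈ A2 := A2.of_shift _ _ _
  have hψap := A2.antiPer hψm
  have hright : ∀ t ∈ Icc p (p + Real.pi / 2), f t ≤ ψ t := by
    intro t ht
    have ht' : t ∈ Icc (p - Real.pi / 2) (p + Real.pi / 2) := ⟨by linarith [ht.1], ht.2⟩
    have e := hmul t ht'
    have hs : 0 ≤ Real.sin (t - p) :=
      Real.sin_nonneg_of_nonneg_of_le_pi (by linarith [ht.1]) (by linarith [ht.2])
    have := mul_le_mul_of_nonneg_right (hmax ht' : h t ≤ h q) hs
    simp only [hf₁] at e
    simp only [hψ]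
    linarith
  have hleft : ∀ t ∈ Icc (p - Real.pi / 2) p, ψ t ≤ f t := by
    intro t ht
    have ht' : t ∈ Icc (p - Real.pi / 2) (p + Real.pi / 2) := ⟨ht.1, by linarith [ht.2]⟩
    have e := hmul t ht'
    have hs : Real.sin (t - p) ≤ 0 :=
      Real.sin_nonpos_of_nonpos_of_neg_pi_le (by linarith [ht.2]) (by linarith [ht.1])
    have := mul_le_mul_of_nonpos_right (hmax ht' : h t ≤ h q) hs
    simp only [hf₁] at e
    simp only [hψ]
    linarith
  have hU : IsUpper f ψ p := by
    refine ⟨hψm, by simp [hψ], fun t ht => ?_, fun t ht => ?_⟩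
    · by_cases htm : t ≤ p + Real.pi / 2
      · exact hright t ⟨ht.1, htm⟩
      · have := hleft (t - Real.pi) ⟨by linarith, by linarith [ht.2]⟩
        rw [hap.sub_pi, hψap.sub_pi] at this
        linarith
    · by_cases htm : p - Real.pi / 2 ≤ t
      · exact hleft t ⟨htm, ht.2⟩
      · have := hright (t + Real.pi) ⟨by linarith [ht.1], by linarith⟩
        rw [hap, hψap] at this
        linarith
  by_cases hqp : q = p
  · by_cases hex : ∃ t ∈ Ioo p (p + Real.pi), f t = ψ t
    · obtain ⟨t, ht, hft⟩ := hex
      exact Or.inr ⟨t, ht.1.ne', by rw [abs_lt]; constructor <;> linarith [ht.1, ht.2],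
        ψ, hU, hft⟩
    · left
      intro t ht
      have e : osculating f p t = ψ t := by simp [osculating, hψ, hqp, hhp]
      rw [e]
      exact lt_of_le_of_ne (hU.le t ⟨ht.1.le, ht.2.le⟩) fun hft => hex ⟨t, ht, hft⟩
  · refine Or.inr ⟨q, hqp, by rw [abs_lt]; constructor <;> linarith [hq.1, hq.2], ψ, hU, ?_⟩
    have := hmul q hq
    simp only [hf₁] at this
    simp only [hψ]
    linarith

/-- Between the ends of a chord there is a flex. -/
lemma IsChord.exists_isNegFlex {f : ℝ → ℝ} (hf : Differentiable ℝ f) (hap : AntiPer f)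
    (hdisc : DiscreteZeros f) {p q : ℝ} (hc : IsChord f p q) :
    ∃ z ∈ Ioo (min p q) (max p q), IsNegFlex f z := by
  by_contra! hno
  have step : ∀ c : {c : ℝ × ℝ // IsChord f c.1 c.2 ∧ uIcc c.1 c.2 ⊆ uIcc p q},
      ∃ c' : {c : ℝ × ℝ // IsChord f c.1 c.2 ∧ uIcc c.1 c.2 ⊆ uIcc p q},
        c'.1.1 = (c.1.1 + c.1.2) / 2 ∧ c'.1.2 ∈ uIcc c.1.1 c.1.2 := by
    rintro ⟨⟨x, y⟩, hxy, hsub⟩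
    have hlt := min_lt_max.2 hxy.1.symm
    have hsum := min_add_max x y
    dsimp only at *
    have hr : (x + y) / 2 ∈ Ioo (min x y) (max x y) := ⟨by linarith, by linarith⟩
    have hrI : (x + y) / 2 ∈ uIcc x y := Ioo_subset_Icc_self hr
    have hs := Icc_subset_Icc_iff hlt.le |>.1 hsub
    obtain ⟨r', hr', hlen, ψ, hψ, hψr⟩ := (isNegFlex_or_isChord hf hap ((x + y) / 2)).resolve_left
      (hno _ ⟨hs.1.trans_lt hr.1, hr.2.trans_le hs.2⟩)
    obtain ⟨y', hy', h1, h2, h3⟩ := hxy.exists_contact hap hdisc hr hψ hr' hlen hψr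
    exact ⟨⟨((x + y) / 2, y'), ⟨h1, h2, ψ, hψ, h3⟩, (uIcc_subset_uIcc hrI hy').trans hsub⟩,
      rfl, hy'⟩
  choose nxt hn1 hn2 using step
  let c : ℕ → {c : ℝ × ℝ // IsChord f c.1 c.2 ∧ uIcc c.1 c.2 ⊆ uIcc p q} :=
    fun n => nxt^[n] ⟨(p, q), hc, subset_rfl⟩
  set x : ℕ → ℝ := fun n => (c n).1.1
  set y : ℕ → ℝ := fun n => (c n).1.2
  have hch : ∀ n, IsChord f (x n) (y n) := fun n => (c n).2.1
  have hin : ∀ n, uIcc (x n) (y n) ⊆ uIcc p q := fun n => (c n).2.2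
  have hcs : ∀ n, c (n + 1) = nxt (c n) := fun n => Function.iterate_succ_apply' _ _ _
  have hx : ∀ n, x (n + 1) = (x n + y n) / 2 := fun n => by
    simp only [x, y, hcs, hn1]
  have hy : ∀ n, y (n + 1) ∈ uIcc (x n) (y n) := fun n => by
    simp only [x, y, hcs]; exact hn2 _
  have hmid : ∀ a b : ℝ, (a + b) / 2 ∈ uIcc a b := fun a b => by
    rw [mem_uIcc]
    rcases le_total a b with h | h
    · left; constructor <;> linarith
    · right; constructor <;> linarith
  have hnest : ∀ n, uIcc (x (n + 1)) (y (n + 1)) ⊆ uIcc (x n) (y n) := fun n =>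
    uIcc_subset_uIcc (hx n ▸ hmid _ _) (hy n)
  have hlen : ∀ n, |y n - x n| ≤ |q - p| * (1 / 2) ^ n := by
    intro n
    induction n with
    | zero => simp [x, y, c]
    | succ n ih =>
      have h1 : |y (n + 1) - x (n + 1)| ≤ |y n - x n| / 2 := by
        have := hy n
        rw [hx, abs_le]
        rw [mem_uIcc] at this
        rcases this with h | h
        · rw [abs_of_nonneg (by linarith [h.1, h.2] : 0 ≤ y n - x n)]
          constructor <;> linarith [h.1, h.2]
        · rw [abs_of_nonpos (by linarith [h.1, h.2] : y n - x n ≤ 0)]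
          constructor <;> linarith [h.1, h.2]
      rw [pow_succ]
      linarith
  have htend : Tendsto (fun n : ℕ => |q - p| * (1 / 2 : ℝ) ^ n) atTop (𝓝 0) := by
    simpa using (tendsto_pow_atTop_nhds_zero_of_lt_one (by norm_num : (0 : ℝ) ≤ 1 / 2)
      (by norm_num)).const_mul |q - p|
  obtain ⟨z, hz⟩ := IsCompact.nonempty_iInter_of_sequence_nonempty_isCompact_isClosed
    (fun n => uIcc (x n) (y n)) hnest (fun n => nonempty_uIcc) isCompact_uIcc
    (fun n => isCompact_uIcc.isClosed)
  rw [mem_iInter] at hz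
  by_cases hinner : ∀ n, z ∈ Ioo (min (x n) (y n)) (max (x n) (y n))
  · obtain ⟨r', hr', hl, ψ, hψ, hψr⟩ := (isNegFlex_or_isChord hf hap z).resolve_left
      (hno _ (hinner 0))
    obtain ⟨ε, hε, H⟩ := hdisc ψ hψ.mem z hψ.eq
    obtain ⟨n, hn⟩ := (htend.eventually (gt_mem_nhds hε)).exists
    obtain ⟨y', hy', h1, -, h3⟩ := (hch n).exists_contact hap hdisc (hinner n) hψ hr' hl hψr
    refine h1 (H y' ?_ h3)
    exact ((abs_sub_le_of_uIcc_subset_uIcc (uIcc_subset_uIcc (hz n) hy')).trans (hlen n)).trans_lt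
      hn
  · push Not at hinner
    obtain ⟨N, hN⟩ := hinner
    have hend : ∀ n, z = x n ∨ z = y n → z = y (n + 1) := by
      intro n hn
      have h1 := hz (n + 1)
      have h2 := hy n
      have h3 := (hch n).1
      simp only [hx, mem_uIcc] at h1 h2
      rcases lt_or_gt_of_ne h3 with h | h <;> rcases hn with hn | hn <;>
        rcases h1 with h1 | h1 <;> rcases h2 with h2 | h2 <;> linarith [h1.1, h1.2, h2.1, h2.2]
    have hNz : z = x N ∨ z = y N := by
      have h1 := hz N
      rcases le_total (x N) (y N) with h | h
      · rw [uIcc_of_le h] at h1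
        rw [min_eq_left h, max_eq_right h] at hN
        by_contra! hcon
        exact hN ⟨lt_of_le_of_ne h1.1 hcon.1.symm, lt_of_le_of_ne h1.2 hcon.2⟩
      · rw [uIcc_of_ge h] at h1
        rw [min_eq_right h, max_eq_left h] at hN
        by_contra! hcon
        exact hN ⟨lt_of_le_of_ne h1.1 hcon.2.symm, lt_of_le_of_ne h1.2 hcon.1⟩
    have hzy : ∀ k, z = y (N + 1 + k) := by
      intro k
      induction k with
      | zero => exact hend N hNz
      | succ k ih => exact hend _ (Or.inr ih)
    obtain ⟨ε, hε, H⟩ := hdisc _ (osculating_mem f z) z (by simp [osculating])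
    obtain ⟨M, hM⟩ := eventually_atTop.1 (htend.eventually (gt_mem_nhds hε))
    have hk := hzy M
    obtain ⟨h1, h2, ψ, hψ, h3⟩ := hch (N + 1 + M)
    have hlM := (hlen (N + 1 + M)).trans_lt (hM _ (by omega))
    rw [← hk] at h1 h2 h3 hlM
    have := hψ.eq_osculating hf h1 h2 h3
    refine h1 (H _ (by rwa [abs_sub_comm]) ?_).symm
    rw [← this]
    exact hψ.eq

lemma osculating_add_pi {f : ℝ → ℝ} (hap : AntiPer f) (p : ℝ) :
    osculating f (p + Real.pi) = osculating f p := by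
  have hd : deriv f (p + Real.pi) = -deriv f p := by
    rw [← deriv_comp_add_const, show (fun t => f (t + Real.pi)) = fun t => -f t from funext hap,
      deriv.fun_neg]
  funext t
  simp only [osculating, hap p, hd, ← sub_sub, Real.cos_sub_pi, Real.sin_sub_pi]
  ring

lemma IsNegFlex.lt_left {f : ℝ → ℝ} (hap : AntiPer f) {p : ℝ} (h : IsNegFlex f p) :
    ∀ t ∈ Ioo (p - Real.pi) p, osculating f p t < f t := by
  intro t ht
  have := h (t + Real.pi) ⟨by linarith [ht.1], by linarith [ht.2]⟩
  rw [hap, A2.antiPer (osculating_mem f p)] at this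
  linarith

lemma cleanFlex2_of_ne {f : ℝ → ℝ} (hap : AntiPer f) {p : ℝ}
    (h : ∀ t ∈ Ioo p (p + Real.pi), f t ≠ osculating f p t) : CleanFlex2 f p := by
  intro φ hφ h0 h1
  obtain rfl := A2.eq_osculating hφ h0 h1
  have hoap := A2.antiPer (osculating_mem f p)
  have himg : ((↑·) : ℝ → AddCircle Real.pi) '' {t : ℝ | f t = osculating f p t} =
      {(p : AddCircle Real.pi)} := by
    refine Subset.antisymm ?_ ?_
    · rintro _ ⟨t, ht, rfl⟩
      have hper : Function.Periodic
          (fun s => (f s = osculating f p s, (s : AddCircle Real.pi))) Real.pi := fun s => by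
        simp only [hap s, hoap s, neg_inj, AddCircle.coe_add_period]
      obtain ⟨s, hs, hst⟩ := hper.exists_mem_Ico Real.pi_pos t p
      obtain ⟨hs1, hs2⟩ := Prod.ext_iff.1 hst
      have hzero : f s = osculating f p s := (iff_of_eq hs1).mp ht
      rcases hs.1.eq_or_lt with hps | hps
      · simp only [mem_singleton_iff]
        rw [hps]
        exact hs2
      · exact (h s ⟨hps, hs.2⟩ hzero).elim
    · rintro _ rfl
      exact ⟨p, h0.symm, rfl⟩
  rw [himg]
  exact isConnected_singleton

lemma IsNegFlex.cleanFlex2 {f : ℝ → ℝ} (hap : AntiPer f) {p : ℝ} (h : IsNegFlex f p) :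
    CleanFlex2 f p :=
  cleanFlex2_of_ne hap fun t ht => (h t ht).ne

lemma IsNegFlex.posToNeg {f : ℝ → ℝ} (hap : AntiPer f) {p : ℝ} (h : IsNegFlex f p) :
    PosToNeg (fun x => f x - osculating f p x) p :=
  ⟨Real.pi, Real.pi_pos, fun t ht => sub_pos.2 (h.lt_left hap t ht),
    fun t ht => sub_neg.2 (h t ht)⟩

lemma IsNegFlex.gt_add_pi {f : ℝ → ℝ} (hap : AntiPer f) {p : ℝ} (h : IsNegFlex f p) :
    ∀ t ∈ Ioo (p + Real.pi) (p + Real.pi + Real.pi), osculating f (p + Real.pi) t < f t := by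
  intro t ht
  have := h (t - Real.pi) ⟨by linarith [ht.1], by linarith [ht.2]⟩
  rw [hap.sub_pi, (A2.antiPer (osculating_mem f p)).sub_pi] at this
  rw [osculating_add_pi hap]
  linarith

lemma IsNegFlex.cleanFlex2_add_pi {f : ℝ → ℝ} (hap : AntiPer f) {p : ℝ} (h : IsNegFlex f p) :
    CleanFlex2 f (p + Real.pi) :=
  cleanFlex2_of_ne hap fun t ht => (h.gt_add_pi hap t ht).ne'

lemma IsNegFlex.negToPos_add_pi {f : ℝ → ℝ} (hap : AntiPer f) {p : ℝ} (h : IsNegFlex f p) :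
    NegToPos (fun x => f x - osculating f (p + Real.pi) x) (p + Real.pi) := by
  refine ⟨Real.pi, Real.pi_pos, fun t ht => ?_, fun t ht => sub_pos.2 (h.gt_add_pi hap t ht)⟩
  rw [osculating_add_pi hap]
  exact sub_neg.2 (h t ⟨by linarith [ht.1], ht.2⟩)

/-- **Theorem 5.4.** A `π`-antiperiodic `C¹` function `f ∉ 𝒜₂` whose differences with
members of `𝒜₂` have discrete zero sets has at least three clean flexes
`t₁ < t₂ < t₃ < t₁ + π` of order 2, with `f - φ_{t₁}` and `f - φ_{t₃}` changing sign from
negative to positive at `t₁`, `t₃`, and `f - φ_{t₂}` from positive to negative at `t₂`. -/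
theorem three_clean_flexes
    (f : ℝ → ℝ) (hf : ContDiff ℝ 1 f) (hap : AntiPer f) (hfA : f ∉ A2)
    (hdisc : DiscreteZeros f) :
    ∃ t₁ t₂ t₃ : ℝ, t₁ < t₂ ∧ t₂ < t₃ ∧ t₃ < t₁ + Real.pi ∧
      CleanFlex2 f t₁ ∧ CleanFlex2 f t₂ ∧ CleanFlex2 f t₃ ∧
      (∀ φ ∈ A2, φ t₁ = f t₁ → deriv φ t₁ = deriv f t₁ →
        NegToPos (fun x => f x - φ x) t₁) ∧
      (∀ φ ∈ A2, φ t₂ = f t₂ → deriv φ t₂ = deriv f t₂ →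
        PosToNeg (fun x => f x - φ x) t₂) ∧
      (∀ φ ∈ A2, φ t₃ = f t₃ → deriv φ t₃ = deriv f t₃ →
        NegToPos (fun x => f x - φ x) t₃) := by
  have hd : Differentiable ℝ f := hf.differentiable one_ne_zero
  have hpi := Real.pi_pos
  obtain ⟨p, hp⟩ : ∃ p, IsNegFlex f p := by
    rcases isNegFlex_or_isChord hd hap 0 with h | ⟨q, h⟩
    · exact ⟨0, h⟩
    · obtain ⟨z, -, hz⟩ := h.exists_isNegFlex hd hap hdisc
      exact ⟨z, hz⟩
  have hnot : ¬ IsNegFlex f (p + Real.pi) := fun h => by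
    have ht : p + Real.pi + Real.pi / 2 ∈ Ioo (p + Real.pi) (p + Real.pi + Real.pi) :=
      ⟨by linarith, by linarith⟩
    exact lt_asymm (h _ ht) (hp.gt_add_pi hap _ ht)
  obtain ⟨q, hq⟩ := (isNegFlex_or_isChord hd hap (p + Real.pi)).resolve_left hnot
  obtain ⟨u, v, hup, hpv, hvu, hu, hv⟩ : ∃ u v, u < p + Real.pi ∧ p + Real.pi < v ∧
      v < u + Real.pi ∧ IsNegFlex f u ∧ IsNegFlex f v := by
    have ⟨hne, hlt, ψ, hψ, hqψ⟩ := hq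
    have hψap := A2.antiPer hψ.mem
    rw [abs_lt] at hlt
    rcases lt_or_gt_of_ne hne with h | h
    · have hq' : IsChord f (p + Real.pi) (q + Real.pi) :=
        ⟨by intro h; linarith, by rw [abs_lt]; constructor <;> linarith, ψ, hψ,
          by rw [hap, hψap, hqψ]⟩
      obtain ⟨u, hu, hu'⟩ := hq.exists_isNegFlex hd hap hdisc
      obtain ⟨v, hv, hv'⟩ := hq'.exists_isNegFlex hd hap hdisc
      rw [min_eq_right (by linarith), max_eq_left (by linarith)] at hu
      rw [min_eq_left (by linarith), max_eq_right (by linarith)] at hv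
      exact ⟨u, v, hu.2, hv.1, by linarith [hu.1, hv.2], hu', hv'⟩
    · have hq' : IsChord f (p + Real.pi) (q - Real.pi) :=
        ⟨by intro h; linarith, by rw [abs_lt]; constructor <;> linarith, ψ, hψ,
          by rw [hap.sub_pi, hψap.sub_pi, hqψ]⟩
      obtain ⟨u, hu, hu'⟩ := hq'.exists_isNegFlex hd hap hdisc
      obtain ⟨v, hv, hv'⟩ := hq.exists_isNegFlex hd hap hdisc
      rw [min_eq_right (by linarith), max_eq_left (by linarith)] at hu
      rw [min_eq_left (by linarith), max_eq_right (by linarith)] at hv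
      exact ⟨u, v, hu.2, hv.1, by linarith [hu.1, hv.2], hu', hv'⟩
  refine ⟨p + Real.pi, v, u + Real.pi, hpv, hvu, by linarith, hp.cleanFlex2_add_pi hap,
    hv.cleanFlex2 hap, hu.cleanFlex2_add_pi hap, ?_, ?_, ?_⟩
  · intro φ hφ h0 h1
    obtain rfl := A2.eq_osculating hφ h0 h1
    exact hp.negToPos_add_pi hap
  · intro φ hφ h0 h1
    obtain rfl := A2.eq_osculating hφ h0 h1
    exact hv.posToNeg hap
  · intro φ hφ h0 h1
    obtain rfl := A2.eq_osculating hφ h0 h1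
    exact hu.negToPos_add_pi hap

end
end

section
/- Let f : ℝ → ℝ be a π-antiperiodic C¹ function not belonging to 𝒜₂ such that for every ψ ∈ 𝒜₂ the zero set of f − ψ is discrete. Then for each p ∈ ℝ there exists exactly one function ψ ∈ 𝒜₂ with ψ(p) = f(p) satisfying: (a) ψ(t) ≥ f(t) for all t ∈ (p, p + π); (b) ψ(t) ≤ f(t) for all t ∈ (p − π, p); (c) if ψ′(p) ≠ f′(p), then ψ(q) = f(q) for some q ∈ (p, p + π). (This unique ψ is called the limiting function of f at p.) -/
open Set Filter Topology

noncomputable section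

/-- The function of `A2` with value `v` and derivative `c` at `p`. -/
def sinusoid (p v c : ℝ) (t : ℝ) : ℝ := v * Real.cos (t - p) + c * Real.sin (t - p)

theorem sinusoid_self (p v c : ℝ) : sinusoid p v c p = v := by simp [sinusoid]

theorem hasDerivAt_sinusoid_self (p v c : ℝ) : HasDerivAt (sinusoid p v c) c p := by
  have h : HasDerivAt (fun t : ℝ => t - p) 1 p := (hasDerivAt_id p).sub_const p
  exact ((h.cos.const_mul v).add (h.sin.const_mul c)).congr_deriv (by simp)

theorem sinusoid_mem_A2 (p v c : ℝ) : sinusoid p v c ∈ A2 := by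
  refine ⟨v * Real.cos p - c * Real.sin p, v * Real.sin p + c * Real.cos p, ?_⟩
  funext t
  simp only [sinusoid, Real.cos_sub, Real.sin_sub]
  ring

theorem exists_eq_sinusoid_of_mem_A2 {ψ : ℝ → ℝ} (h : ψ ∈ A2) (p : ℝ) :
    ∃ c, ψ = sinusoid p (ψ p) c := by
  obtain ⟨a, b, rfl⟩ := h
  refine ⟨b * Real.cos p - a * Real.sin p, ?_⟩
  funext t
  simp only [sinusoid, Real.cos_sub, Real.sin_sub]
  linear_combination (-(a * Real.cos t + b * Real.sin t)) * Real.sin_sq_add_cos_sq p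

theorem antiPer_sinusoid (p v c : ℝ) : AntiPer (sinusoid p v c) := by
  intro t
  have h : t + Real.pi - p = (t - p) + Real.pi := by ring
  simp only [sinusoid, h, Real.cos_add_pi, Real.sin_add_pi]
  ring

/-- The slope `c` at `p` for which `sinusoid p (f p) c` meets `f` at `t`, extended to `t = p` by
continuity. -/
def meetingSlope (f : ℝ → ℝ) (p t : ℝ) : ℝ :=
  dslope (fun s => f s - f p * Real.cos (s - p)) p t / Real.sinc (t - p)

theorem sinc_sub_pos {p t : ℝ} (ht : t ∈ Icc (p - Real.pi / 2) (p + Real.pi / 2)) :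
    0 < Real.sinc (t - p) := by
  have hπ := Real.pi_pos
  rcases lt_trichotomy t p with h | rfl | h
  · rw [Real.sinc_of_ne_zero (by linarith)]
    exact div_pos_of_neg_of_neg
      (Real.sin_neg_of_neg_of_neg_pi_lt (by linarith) (by linarith [ht.1])) (by linarith)
  · simp
  · rw [Real.sinc_of_ne_zero (by linarith)]
    exact div_pos (Real.sin_pos_of_pos_of_lt_pi (by linarith) (by linarith [ht.2])) (by linarith)

theorem meetingSlope_self {f : ℝ → ℝ} {p : ℝ} (hf : DifferentiableAt ℝ f p) :
    meetingSlope f p p = deriv f p := by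
  have h : HasDerivAt (fun t : ℝ => t - p) 1 p := (hasDerivAt_id p).sub_const p
  have h2 := hf.hasDerivAt.sub (h.cos.const_mul (f p))
  have h3 : deriv (fun s => f s - f p * Real.cos (s - p)) p = deriv f p := by
    exact h2.deriv.trans (by simp)
  simp [meetingSlope, dslope_same, h3]

theorem eq_sinusoid_meetingSlope (f : ℝ → ℝ) {p t : ℝ}
    (ht : t ∈ Icc (p - Real.pi / 2) (p + Real.pi / 2)) :
    f t = sinusoid p (f p) (meetingSlope f p t) t := by
  have h1 := sub_smul_dslope (fun s => f s - f p * Real.cos (s - p)) p t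
  have h2 : Real.sin (t - p) = Real.sinc (t - p) * (t - p) := by
    by_cases h : t - p = 0
    · simp [h]
    · rw [Real.sinc_of_ne_zero h]; field_simp
  have h3 := (sinc_sub_pos ht).ne'
  simp only [smul_eq_mul, sub_self, Real.cos_zero, mul_one, sub_zero] at h1
  simp only [sinusoid, meetingSlope]
  rw [h2, ← mul_assoc, div_mul_cancel₀ _ h3]
  linarith

theorem continuousOn_meetingSlope {f : ℝ → ℝ} (hf : Differentiable ℝ f) (p : ℝ) :
    ContinuousOn (meetingSlope f p) (Icc (p - Real.pi / 2) (p + Real.pi / 2)) := by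
  have hN : Differentiable ℝ (fun s => f s - f p * Real.cos (s - p)) := by fun_prop
  have hd : Continuous (dslope (fun s => f s - f p * Real.cos (s - p)) p) := by
    rw [← continuousOn_univ]
    exact (continuousOn_dslope univ_mem).2 ⟨hN.continuous.continuousOn, hN p⟩
  exact hd.continuousOn.div
    (Real.continuous_sinc.comp (continuous_id.sub continuous_const)).continuousOn
    fun t ht => (sinc_sub_pos ht).ne'

theorem AntiPer.le_iff_add_pi {f g : ℝ → ℝ} (hf : AntiPer f) (hg : AntiPer g) (t : ℝ) :
    f (t + Real.pi) ≤ g (t + Real.pi) ↔ g t ≤ f t := by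
  rw [hf t, hg t, neg_le_neg_iff]

theorem isLimiting_sinusoid_of_isMaxOn {f : ℝ → ℝ} (hf : Differentiable ℝ f) (hap : AntiPer f)
    {p q : ℝ} (hq : q ∈ Icc (p - Real.pi / 2) (p + Real.pi / 2))
    (hmax : IsMaxOn (meetingSlope f p) (Icc (p - Real.pi / 2) (p + Real.pi / 2)) q) :
    IsLimiting f (sinusoid p (f p) (meetingSlope f p q)) p := by
  have hπ := Real.pi_pos
  set c := meetingSlope f p q with hc
  have hψ := antiPer_sinusoid p (f p) c
  have right : ∀ t ∈ Ioc p (p + Real.pi / 2), f t ≤ sinusoid p (f p) c t := by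
    intro t ht
    have htK : t ∈ Icc (p - Real.pi / 2) (p + Real.pi / 2) := ⟨by linarith [ht.1], ht.2⟩
    rw [eq_sinusoid_meetingSlope f htK]
    have hs : 0 ≤ Real.sin (t - p) :=
      Real.sin_nonneg_of_nonneg_of_le_pi (by linarith [ht.1]) (by linarith [ht.2])
    have := mul_le_mul_of_nonneg_right (hmax htK) hs
    simp only [sinusoid]
    linarith
  have left : ∀ t ∈ Ico (p - Real.pi / 2) p, sinusoid p (f p) c t ≤ f t := by
    intro t ht
    have htK : t ∈ Icc (p - Real.pi / 2) (p + Real.pi / 2) := ⟨ht.1, by linarith [ht.2]⟩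
    rw [eq_sinusoid_meetingSlope f htK]
    have hs : Real.sin (t - p) ≤ 0 :=
      Real.sin_nonpos_of_nonpos_of_neg_pi_le (by linarith [ht.2]) (by linarith [ht.1])
    have := mul_le_mul_of_nonpos_right (hmax htK) hs
    simp only [sinusoid]
    linarith
  have upper : ∀ t ∈ Ioo p (p + Real.pi), f t ≤ sinusoid p (f p) c t := by
    intro t ht
    by_cases h : t ≤ p + Real.pi / 2
    · exact right t ⟨ht.1, h⟩
    · have := (hap.le_iff_add_pi hψ (t - Real.pi)).2
        (left _ ⟨by linarith, by linarith [ht.2]⟩)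
      simpa using this
  refine ⟨sinusoid_mem_A2 _ _ _, sinusoid_self _ _ _, upper, fun t ht => ?_, fun hne => ?_⟩
  · exact (hap.le_iff_add_pi hψ t).1
      (upper _ ⟨by linarith [ht.1], by linarith [ht.2]⟩)
  · have hmeet := eq_sinusoid_meetingSlope f hq
    rw [← hc] at hmeet
    rcases lt_trichotomy q p with h | h | h
    · exact ⟨q + Real.pi, ⟨by linarith [hq.1], by linarith⟩, by rw [hψ q, hap q, ← hmeet]⟩
    · refine absurd ?_ hne
      rw [(hasDerivAt_sinusoid_self _ _ _).deriv, hc, h, meetingSlope_self (hf p)]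
    · exact ⟨q, ⟨h, by linarith [hq.2]⟩, hmeet.symm⟩

theorem deriv_le_of_isLimiting_sinusoid {f : ℝ → ℝ} (hf : Differentiable ℝ f) {p c : ℝ}
    (h : IsLimiting f (sinusoid p (f p) c) p) : deriv f p ≤ c := by
  have hπ := Real.pi_pos
  have hd : HasDerivAt (fun t => sinusoid p (f p) c t - f t) (c - deriv f p) p :=
    (hasDerivAt_sinusoid_self p (f p) c).sub (hf p).hasDerivAt
  have ht := hd.tendsto_slope.mono_left
    (nhdsWithin_mono p (fun x (hx : p < x) => hx.ne') : 𝓝[>] p ≤ 𝓝[≠] p)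
  refine sub_nonneg.1 (ge_of_tendsto ht ?_)
  filter_upwards [Ioo_mem_nhdsGT (show p < p + Real.pi by linarith)] with t htm
  rw [slope_def_field, sinusoid_self, sub_self, sub_zero]
  exact div_nonneg (sub_nonneg.2 (h.2.2.1 t htm)) (by linarith [htm.1])

theorem IsLimiting.sinusoid_le {f : ℝ → ℝ} (hf : Differentiable ℝ f) {p c d : ℝ}
    (hc : IsLimiting f (sinusoid p (f p) c) p) (hd : IsLimiting f (sinusoid p (f p) d) p) :
    d ≤ c := by
  by_contra! hlt
  have hne : deriv (sinusoid p (f p) d) p ≠ deriv f p := by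
    rw [(hasDerivAt_sinusoid_self _ _ _).deriv]
    exact ((deriv_le_of_isLimiting_sinusoid hf hc).trans_lt hlt).ne'
  obtain ⟨q, hq, hmeet⟩ := hd.2.2.2.2 hne
  have hle := hc.2.2.1 q hq
  have hs : 0 < Real.sin (q - p) :=
    Real.sin_pos_of_pos_of_lt_pi (by linarith [hq.1]) (by linarith [hq.2])
  have := mul_lt_mul_of_pos_right hlt hs
  simp only [sinusoid] at hle hmeet
  linarith

/-- **Lemma 5.6.** For every `p` there is exactly one function `ψ ∈ 𝒜₂` with
`ψ(p) = f(p)` satisfying (a), (b), (c): the limiting function of `f` at `p`. -/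
theorem limiting_function_exists_unique
    (f : ℝ → ℝ) (hf : ContDiff ℝ 1 f) (hap : AntiPer f) (hfA : f ∉ A2)
    (hdisc : DiscreteZeros f) :
    ∀ p : ℝ, ∃! ψ : ℝ → ℝ, IsLimiting f ψ p := by
  intro p
  have hπ := Real.pi_pos
  have hd : Differentiable ℝ f := hf.differentiable one_ne_zero
  obtain ⟨q, hq, hmax⟩ := isCompact_Icc.exists_isMaxOn
    (nonempty_Icc.2 (show p - Real.pi / 2 ≤ p + Real.pi / 2 by linarith))
    (continuousOn_meetingSlope hd p)
  have hlim := isLimiting_sinusoid_of_isMaxOn hd hap hq hmax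
  refine ⟨_, hlim, fun ψ hψ => ?_⟩
  obtain ⟨c, hc⟩ := exists_eq_sinusoid_of_mem_A2 hψ.1 p
  rw [hψ.2.1] at hc
  subst hc
  rw [le_antisymm (hlim.sinusoid_le hd hψ) (hψ.sinusoid_le hd hlim)]

end
end

section
/- Let γ : P¹ → P² be a C¹-regular anti-convex simple closed curve, let [a,b] be a closed interval in P¹ with γ(a) ≠ γ(b), and let L be a projective line through γ(a) and γ(b). Then one of the two closed segments of L bounded by γ(a) and γ(b), say L₁, has the property that γ([a,b]) ∪ L₁ is contained in an affine chart A² ⊂ P², while γ([a,b]) ∪ L₂ (where L₂ is the other segment) is not null-homotopic in P². Moreover, if γ restricted to [a,b] meets L exactly at the parameters a = t₁ < t₂ < ⋯ < tₙ = b, then the points γ(t₁), γ(t₂), …, γ(tₙ) lie on the segment L₁ in this order. -/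
open Set Filter Topology Matrix

noncomputable section

/-!  We work with the lift `γ̂ = c : ℝ → S² ⊂ ℝ³` of a (non-contractible) simple closed
curve `γ : P¹ → P²`, so that `c` is `π`-antiperiodic and projective notions are expressed
through vectors in `ℝ³ = Fin 3 → ℝ`: projective points are antipodal pairs `±x` of unit
vectors, and projective lines are great circles `{x : v ⬝ᵥ x = 0}`. -/

/-- Normalization of a nonzero vector to the unit sphere. -/
noncomputable def unitize (x : Fin 3 → ℝ) : Fin 3 → ℝ :=
  (Real.sqrt (x ⬝ᵥ x))⁻¹ • x

/-- The closed arc of a great circle consisting of normalized nonnegative combinations of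
`A` and `B`; its projection to `P²` is the closed projective segment bounded by `[A]` and
`[B]` determined by the pair `(A,B)` of lifts. -/
def SegArc (A B : Fin 3 → ℝ) : Set (Fin 3 → ℝ) :=
  {x | ∃ s t : ℝ, 0 ≤ s ∧ 0 ≤ t ∧ s • A + t • B ≠ 0 ∧ x = unitize (s • A + t • B)}

/-- `t₀` is a *true inflection point* of the curve `c`: the tangent line of `c` at `t₀`
(the great circle with normal `v`, where `v ⊥ c t₀` and `v ⊥ c′ t₀`) crosses the curve in
an arc containing `t₀`, i.e. the height function `t ↦ v ⬝ᵥ c t` changes sign at the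
connected component of its zero set containing `t₀`. -/
def IsTrueInflection (c : ℝ → (Fin 3 → ℝ)) (t₀ : ℝ) : Prop :=
  ∀ v : Fin 3 → ℝ, v ≠ 0 → v ⬝ᵥ c t₀ = 0 → v ⬝ᵥ deriv c t₀ = 0 →
    ∃ k₁ k₂ : ℝ, k₁ ≤ t₀ ∧ t₀ ≤ k₂ ∧ SignChange (fun t => v ⬝ᵥ c t) k₁ k₂

/-- Two true inflection points of `c` (viewed in `P¹ = ℝ/πℤ`) are *independent* if they
are not contained in one arc of the curve consisting entirely of true inflection points. -/
def IndepInfl (c : ℝ → (Fin 3 → ℝ)) (s t : ℝ) : Prop :=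
  ¬ ∃ d e : ℝ, d ≤ e ∧ (∃ n : ℤ, s + Real.pi * n ∈ Icc d e) ∧
      (∃ n : ℤ, t + Real.pi * n ∈ Icc d e) ∧ ∀ x ∈ Icc d e, IsTrueInflection c x

/-- A family of pairwise independent true inflection points of `c`
(with normalized representatives in `[0,π)`). -/
def InflFamily (c : ℝ → (Fin 3 → ℝ)) (S : Set ℝ) : Prop :=
  (∀ s ∈ S, s ∈ Ico (0:ℝ) Real.pi ∧ IsTrueInflection c s) ∧ S.Pairwise (IndepInfl c)

/-- The *reduction* of `c` with respect to `[a,b]` (and the choice `ε = ±1` of the lift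
`ε • c b` of `γ(b)` determining the chord): the curve obtained by replacing `c|_[a,b]`
with the chord from `c a` to `ε • c b`, extended `π`-antiperiodically. -/
noncomputable def redFun (c : ℝ → (Fin 3 → ℝ)) (a b ε : ℝ) : ℝ → (Fin 3 → ℝ) :=
  fun t =>
    ((-1 : ℝ) ^ (⌊(t - a) / Real.pi⌋)) •
      (if t - ⌊(t - a) / Real.pi⌋ * Real.pi ≤ b then
        unitize ((b - (t - ⌊(t - a) / Real.pi⌋ * Real.pi)) • c a +
          ((t - ⌊(t - a) / Real.pi⌋ * Real.pi) - a) • (ε • c b))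
      else c (t - ⌊(t - a) / Real.pi⌋ * Real.pi))

/-- `[a,b]` is an *inflection interval* of the curve `c`: `a` is a true inflection point
of `c` and `c([a,b])` is the connected component of the intersection of `c` with the
tangent line at `a` containing `c a` (in parameter space: the connected component of the
parameter zero set of the tangent line height function containing `a` is `[a,b]`). -/
def IsInflInterval (c : ℝ → (Fin 3 → ℝ)) (a b : ℝ) : Prop :=
  IsTrueInflection c a ∧
  ∀ v : Fin 3 → ℝ, v ≠ 0 → v ⬝ᵥ c a = 0 → v ⬝ᵥ deriv c a = 0 →
    connectedComponentIn {t : ℝ | v ⬝ᵥ c t = 0} a = Icc a b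

/-- `(a,b)` (a nonempty proper open interval of `P¹ = ℝ/πℤ`, in real coordinates
`a < b < a + π`) is a *double tangent interval* of the curve `c`:
for the chord `γ(a)γ(b)` — the projective segment (determined by a sign `ε = ±1`, namely
the arc `SegArc (c a) (ε • c b)`) such that `γ([a,b])` together with the chord lies in an
affine chart (the complement of some line `{w ⬝ᵥ x = 0}`) —
(1) the chord is tangent to `γ` at `γ(a)` and `γ(b)`,
(2) some point of `γ([a,b])` does not lie on the chord, and
(3) `[a,b]` is not an inflection interval of the reduction of `γ` w.r.t. `[a,b]`. -/
def IsDTI (c : ℝ → (Fin 3 → ℝ)) (a b : ℝ) : Prop :=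
  a < b ∧ b < a + Real.pi ∧
  ∃ ε : ℝ, (ε = 1 ∨ ε = -1) ∧
    (∃ w : Fin 3 → ℝ, (∀ t ∈ Icc a b, w ⬝ᵥ c t ≠ 0) ∧
      ∀ x ∈ SegArc (c a) (ε • c b), w ⬝ᵥ x ≠ 0) ∧
    (crossProduct (c a) (c b)) ⬝ᵥ deriv c a = 0 ∧
    (crossProduct (c a) (c b)) ⬝ᵥ deriv c b = 0 ∧
    (∃ t ∈ Icc a b, c t ∉ SegArc (c a) (ε • c b) ∧ (- c t) ∉ SegArc (c a) (ε • c b)) ∧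
    ¬ IsInflInterval (redFun c a b ε) a b

/-- Two double tangent intervals, viewed as intervals of `P¹ = ℝ/πℤ`, are *independent*
if they are disjoint or the closure of one is contained in the other. -/
def IndepDTI (p q : ℝ × ℝ) : Prop :=
  ((((↑·) : ℝ → AddCircle Real.pi) '' Ioo p.1 p.2) ∩
    (((↑·) : ℝ → AddCircle Real.pi) '' Ioo q.1 q.2) = ∅) ∨
  ((((↑·) : ℝ → AddCircle Real.pi) '' Icc p.1 p.2) ⊆
    (((↑·) : ℝ → AddCircle Real.pi) '' Ioo q.1 q.2)) ∨
  ((((↑·) : ℝ → AddCircle Real.pi) '' Icc q.1 q.2) ⊆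
    (((↑·) : ℝ → AddCircle Real.pi) '' Ioo p.1 p.2))

/-- A family of pairwise independent double tangent intervals of `c`
(with normalized representatives `a ∈ [0,π)`). -/
def DTIFamily (c : ℝ → (Fin 3 → ℝ)) (D : Set (ℝ × ℝ)) : Prop :=
  (∀ p ∈ D, p.1 ∈ Ico (0:ℝ) Real.pi ∧ IsDTI c p.1 p.2) ∧ D.Pairwise IndepDTI

/-- A maximal family of pairwise independent double tangent intervals of `c`. -/
def MaxDTIFamily (c : ℝ → (Fin 3 → ℝ)) (D : Set (ℝ × ℝ)) : Prop :=
  DTIFamily c D ∧ ∀ D' : Set (ℝ × ℝ), DTIFamily c D' → D ⊆ D' → D' = D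

theorem unitize_smul_of_unit {x : Fin 3 → ℝ} (hx : x ⬝ᵥ x = 1) {r : ℝ} (hr : 0 < r) :
    unitize (r • x) = x := by
  have h : (r • x) ⬝ᵥ (r • x) = r ^ 2 := by
    rw [smul_dotProduct, dotProduct_smul, hx, smul_eq_mul, smul_eq_mul]; ring
  rw [unitize, h, Real.sqrt_sq hr.le, smul_smul, inv_mul_cancel₀ hr.ne', one_smul]

theorem dotProduct_self_pos {x : Fin 3 → ℝ} (hx : x ≠ 0) : 0 < x ⬝ᵥ x :=
  (Finset.sum_nonneg fun i _ => mul_self_nonneg (x i)).lt_of_ne'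
    fun h => hx (dotProduct_self_eq_zero.1 h)

theorem continuousOn_unitize : ContinuousOn unitize {0}ᶜ := by
  have hd : Continuous fun x : Fin 3 → ℝ => x ⬝ᵥ x := continuous_id.dotProduct continuous_id
  refine ContinuousOn.smul (ContinuousOn.inv₀ hd.sqrt.continuousOn fun x hx => ?_) continuousOn_id
  exact (Real.sqrt_pos.2 (dotProduct_self_pos hx)).ne'

theorem eq_zero_of_smul_add_smul_eq_zero {A B : Fin 3 → ℝ} (hA : A ⬝ᵥ A = 1) (hB : B ⬝ᵥ B = 1)
    (hne : A ≠ B ∧ A ≠ -B) {p q : ℝ} (h : p • A + q • B = 0) : p = 0 ∧ q = 0 := by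
  have h1 := congrArg (fun x => A ⬝ᵥ x) h
  have h2 := congrArg (fun x => B ⬝ᵥ x) h
  simp only [dotProduct_add, dotProduct_smul, hA, hB, smul_eq_mul, dotProduct_zero,
    dotProduct_comm B A] at h1 h2
  have hsq : (p - q) * (p + q) = 0 := by linear_combination p * h1 - q * h2
  by_cases hp : p = 0
  · subst hp
    exact ⟨rfl, by simpa using hsq⟩
  · exfalso
    rcases mul_eq_zero.1 hsq with hpq | hpq
    · obtain rfl : q = p := by linarith
      rw [← smul_add] at h
      exact hne.2 (eq_neg_of_add_eq_zero_left ((smul_eq_zero.1 h).resolve_left hp))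
    · obtain rfl : q = -p := by linarith
      rw [neg_smul, ← sub_eq_add_neg, ← smul_sub] at h
      exact hne.1 (sub_eq_zero.1 ((smul_eq_zero.1 h).resolve_left hp))

/-- A vector of the plane orthogonal to `v ≠ 0` is a combination of any two independent unit
vectors of that plane. -/
theorem exists_eq_smul_add_smul {A B X v : Fin 3 → ℝ} (hA : A ⬝ᵥ A = 1) (hB : B ⬝ᵥ B = 1)
    (hne : A ≠ B ∧ A ≠ -B) (hv : v ≠ 0) (hvA : v ⬝ᵥ A = 0) (hvB : v ⬝ᵥ B = 0)
    (hvX : v ⬝ᵥ X = 0) : ∃ α β : ℝ, X = α • A + β • B := by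
  have hdet : (Matrix.of ![A, B, X]).det = 0 := by
    refine Matrix.exists_mulVec_eq_zero_iff.1 ⟨v, hv, ?_⟩
    ext i
    fin_cases i
    · exact (dotProduct_comm _ _).trans hvA
    · exact (dotProduct_comm _ _).trans hvB
    · exact (dotProduct_comm _ _).trans hvX
  obtain ⟨u, hu, hu0⟩ := Matrix.exists_vecMul_eq_zero_iff.2 hdet
  have hrel : u 0 • A + u 1 • B + u 2 • X = 0 := by
    ext j
    have := congrFun hu0 j
    simpa [Matrix.vecMul, dotProduct, Fin.sum_univ_three] using this
  have h2 : u 2 ≠ 0 := by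
    intro h2
    rw [h2, zero_smul, add_zero] at hrel
    obtain ⟨h0, h1⟩ := eq_zero_of_smul_add_smul_eq_zero hA hB hne hrel
    apply hu
    ext i
    fin_cases i <;> assumption
  refine ⟨-(u 0 / u 2), -(u 1 / u 2), ?_⟩
  ext j
  have := congrFun hrel j
  simp only [Pi.add_apply, Pi.smul_apply, smul_eq_mul, Pi.zero_apply] at this ⊢
  field_simp
  linarith

/-- At every parameter `s`, anti-convexity yields a line through `c s` alone, oriented so that
the lift lies on its positive side during the following half-turn and on its negative side
during the preceding one. -/
theorem exists_transversal_sign {c : ℝ → Fin 3 → ℝ} (hc : Continuous c)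
    (hap : ∀ t, c (t + Real.pi) = - c t)
    (hsimple : ∀ s t : ℝ, (c s = c t ∨ c s = - c t) → ∃ n : ℤ, t - s = Real.pi * n)
    (hac : ∀ s : ℝ, ∃ w : Fin 3 → ℝ, w ⬝ᵥ c s = 0 ∧ w ⬝ᵥ deriv c s ≠ 0 ∧
      ∀ t : ℝ, c t ≠ c s → c t ≠ - c s → w ⬝ᵥ c t ≠ 0) (s : ℝ) :
    ∃ w : Fin 3 → ℝ, w ⬝ᵥ c s = 0 ∧ (∀ t ∈ Ioo s (s + Real.pi), 0 < w ⬝ᵥ c t) ∧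
      ∀ t ∈ Ioo (s - Real.pi) s, w ⬝ᵥ c t < 0 := by
  obtain ⟨w, hws, -, hw⟩ := hac s
  have hpi := Real.pi_pos
  have hne : ∀ t ∈ Ioo s (s + Real.pi), w ⬝ᵥ c t ≠ 0 := by
    intro t ht
    have key : ¬ (c s = c t ∨ c s = -c t) := by
      intro h
      obtain ⟨n, hn⟩ := hsimple s t h
      have h0 : (0 : ℝ) < n := by
        by_contra! h'
        nlinarith [ht.1]
      have h1 : (n : ℝ) < 1 := by
        by_contra! h'
        nlinarith [ht.2]
      have h0' : 0 < n := by exact_mod_cast h0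
      have h1' : n < 1 := by exact_mod_cast h1
      omega
    refine hw t (fun h => key (Or.inl h.symm)) fun h => key (Or.inr ?_)
    rw [h, neg_neg]
  have hcont : Continuous fun t => w ⬝ᵥ c t := continuous_const.dotProduct hc
  have hsign : (∀ t ∈ Ioo s (s + Real.pi), 0 < w ⬝ᵥ c t) ∨
      ∀ t ∈ Ioo s (s + Real.pi), w ⬝ᵥ c t < 0 := by
    by_contra! h
    obtain ⟨⟨x, hx, hx0⟩, y, hy, hy0⟩ := h
    obtain ⟨z, hz, hz0⟩ := isPreconnected_Ioo.intermediate_value hx hy hcont.continuousOn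
      ⟨hx0, hy0⟩
    exact hne z hz hz0
  have hshift : ∀ t, w ⬝ᵥ c (t + Real.pi) = -(w ⬝ᵥ c t) := fun t => by rw [hap, dotProduct_neg]
  have hmem : ∀ t ∈ Ioo (s - Real.pi) s, t + Real.pi ∈ Ioo s (s + Real.pi) := fun t ht =>
    ⟨by linarith [ht.1], by linarith [ht.2]⟩
  rcases hsign with h | h
  · refine ⟨w, hws, h, fun t ht => ?_⟩
    linarith [hshift t, h _ (hmem t ht)]
  · refine ⟨-w, by rw [neg_dotProduct, hws, neg_zero], fun t ht => ?_, fun t ht => ?_⟩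
    · rw [neg_dotProduct]
      linarith [h t ht]
    · rw [neg_dotProduct]
      linarith [hshift t, h _ (hmem t ht)]

/-- The arc between two independent unit vectors is connected and contains both of them. -/
theorem exists_isConnected_subset_segArc {A B : Fin 3 → ℝ} (hA : A ⬝ᵥ A = 1) (hB : B ⬝ᵥ B = 1)
    (hne : A ≠ B ∧ A ≠ -B) : ∃ S : Set (Fin 3 → ℝ), IsConnected S ∧ S ⊆ SegArc A B ∧
      A ∈ S ∧ B ∈ S := by
  have h0 : ∀ θ : ℝ, (1 - θ) • A + θ • B ≠ 0 := by
    intro θ h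
    obtain ⟨h1, h2⟩ := eq_zero_of_smul_add_smul_eq_zero hA hB hne h
    linarith
  refine ⟨(fun θ : ℝ => unitize ((1 - θ) • A + θ • B)) '' Icc 0 1, ?_, ?_, ?_, ?_⟩
  · refine (isConnected_Icc zero_le_one).image _ ?_
    exact continuousOn_unitize.comp (by fun_prop) fun θ _ => h0 θ
  · rintro _ ⟨θ, hθ, rfl⟩
    exact ⟨1 - θ, θ, by linarith [hθ.2], hθ.1, h0 θ, rfl⟩
  · refine ⟨0, by simp, ?_⟩
    simpa using unitize_smul_of_unit hA one_pos
  · refine ⟨1, by simp, ?_⟩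
    simpa using unitize_smul_of_unit hB one_pos

/-- **Lemma 4.1 and Proposition 4.2.** Let `γ : P¹ → P²` be a `C¹`-regular anti-convex
simple closed curve (given through its `π`-antiperiodic lift `c : ℝ → S²`), `[a,b]` a
closed interval of `P¹` with `γ(a) ≠ γ(b)`, and `L` a projective line (given by its
normal `v`) through `γ(a)` and `γ(b)`.  Then one of the two closed segments of `L`
bounded by `γ(a)` and `γ(b)` — the segment `L₁` given by the arc `SegArc (c a) (ε • c b)`
for a suitable sign `ε = ±1` — is such that `γ([a,b]) ∪ L₁` is contained in an affine
chart (the complement of some projective line `{w ⬝ᵥ x = 0}`), while `γ([a,b]) ∪ L₂` is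
not null-homotopic in `P²` (in the double cover: the component of the lift of `L₂`
containing `c b` also contains `-c a`, so the loop `γ|[a,b]` followed by `L₂` lifts to a
path joining the antipodal points `c a` and `-c a`).  Moreover if `γ|[a,b]` meets `L`
exactly at `a = t₁ < t₂ < ⋯ < tₙ = b`, then `γ(t₁), …, γ(tₙ)` lie on `L₁` in this order. -/
theorem chord_and_order
    (c : ℝ → (Fin 3 → ℝ))
    (hsm : ContDiff ℝ 1 c)
    (hunit : ∀ t, c t ⬝ᵥ c t = 1)
    (hap : ∀ t, c (t + Real.pi) = - c t)
    (hreg : ∀ t, deriv c t ≠ 0)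
    (hsimple : ∀ s t : ℝ, (c s = c t ∨ c s = - c t) → ∃ n : ℤ, t - s = Real.pi * n)
    (hac : ∀ s : ℝ, ∃ w : Fin 3 → ℝ, w ⬝ᵥ c s = 0 ∧ w ⬝ᵥ deriv c s ≠ 0 ∧
      ∀ t : ℝ, c t ≠ c s → c t ≠ - c s → w ⬝ᵥ c t ≠ 0)
    (a b : ℝ) (hab : a < b) (hab' : b < a + Real.pi)
    (hne : c a ≠ c b ∧ c a ≠ - c b)
    (v : Fin 3 → ℝ) (hv : v ≠ 0) (hva : v ⬝ᵥ c a = 0) (hvb : v ⬝ᵥ c b = 0) :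
    ∃ ε : ℝ, (ε = 1 ∨ ε = -1) ∧
      -- `γ([a,b]) ∪ L₁` lies in an affine chart
      (∃ w : Fin 3 → ℝ, (∀ t ∈ Icc a b, w ⬝ᵥ c t ≠ 0) ∧
        ∀ x ∈ SegArc (c a) (ε • c b), w ⬝ᵥ x ≠ 0) ∧
      -- `γ([a,b]) ∪ L₂` is not null-homotopic
      (∃ S : Set (Fin 3 → ℝ), IsConnected S ∧
        S ⊆ SegArc (c a) ((-ε) • c b) ∪ SegArc (-(c a)) (ε • c b) ∧
        c b ∈ S ∧ -(c a) ∈ S) ∧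
      -- the intersection points lie on `L₁` in order
      (∀ n : ℕ, ∀ hn : 2 ≤ n, ∀ T : Fin n → ℝ, StrictMono T →
        T ⟨0, by omega⟩ = a → T ⟨n - 1, by omega⟩ = b →
        (∀ i, v ⬝ᵥ c (T i) = 0) →
        (∀ x ∈ Icc a b, v ⬝ᵥ c x = 0 → ∃ i, x = T i) →
        ∃ θ : Fin n → ℝ, Monotone θ ∧ (∀ i, θ i ∈ Icc (0:ℝ) 1) ∧
          ∀ i, c (T i) = unitize ((1 - θ i) • c a + (θ i) • (ε • c b)) ∨
               c (T i) = - unitize ((1 - θ i) • c a + (θ i) • (ε • c b))) := by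
  have hpi := Real.pi_pos
  have hsign := exists_transversal_sign hsm.continuous hap hsimple hac
  refine ⟨1, Or.inl rfl, ?_, ?_, ?_⟩
  · obtain ⟨w, -, hw, -⟩ := hsign ((a + b - Real.pi) / 2)
    have hpos : ∀ t ∈ Icc a b, 0 < w ⬝ᵥ c t := fun t ht =>
      hw t ⟨by linarith [ht.1], by linarith [ht.2]⟩
    refine ⟨w, fun t ht => (hpos t ht).ne', ?_⟩
    rintro _ ⟨s, t, hs, ht, hst, rfl⟩
    have ha := hpos a ⟨le_rfl, hab.le⟩
    have hb := hpos b ⟨hab.le, le_rfl⟩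
    have hlin : 0 < w ⬝ᵥ (s • c a + t • (1 : ℝ) • c b) := by
      rw [one_smul, dotProduct_add, dotProduct_smul, dotProduct_smul, smul_eq_mul, smul_eq_mul]
      rcases hs.eq_or_lt with rfl | hs
      · have ht0 : t ≠ 0 := by
          rintro rfl
          simp at hst
        have := mul_pos (ht.lt_of_ne' ht0) hb
        linarith
      · linarith [mul_pos hs ha, mul_nonneg ht hb.le]
    rw [unitize, dotProduct_smul, smul_eq_mul]
    exact mul_ne_zero (inv_ne_zero (Real.sqrt_pos.2 (dotProduct_self_pos hst)).ne') hlin.ne'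
  · obtain ⟨S, hS, hsub, hA, hB⟩ := exists_isConnected_subset_segArc (A := -c a) (B := c b)
      (by rw [neg_dotProduct_neg, hunit]) (hunit b)
      ⟨fun h => hne.2 (neg_eq_iff_eq_neg.1 h), fun h => hne.1 (neg_injective h)⟩
    exact ⟨S, hS, by simpa using hsub.trans subset_union_right, hB, hA⟩
  · intro n hn T hT hT0 hT1 hvT _
    have hTmem : ∀ i, T i ∈ Icc a b := fun i =>
      ⟨hT0 ▸ hT.monotone (Fin.mk_le_of_le_val (Nat.zero_le _)),
        hT1 ▸ hT.monotone (Fin.le_def.2 (by have := i.2; simp only; omega))⟩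
    have hcoord : ∀ i, ∃ α β : ℝ, 0 ≤ α ∧ 0 ≤ β ∧ 0 < α + β ∧ c (T i) = α • c a + β • c b := by
      intro i
      obtain ⟨α, β, h⟩ := exists_eq_smul_add_smul (hunit a) (hunit b) hne hv hva hvb (hvT i)
      have hα : 0 ≤ α := by
        obtain ⟨w, hw0, -, hw⟩ := hsign b
        have ha := hw a ⟨by linarith, hab⟩
        have ht : w ⬝ᵥ c (T i) ≤ 0 := by
          rcases (hTmem i).2.eq_or_lt with h' | h'
          · rw [h', hw0]
          · exact (hw _ ⟨by linarith [(hTmem i).1], h'⟩).le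
        rw [h, dotProduct_add, dotProduct_smul, dotProduct_smul, hw0, smul_eq_mul, smul_zero,
          add_zero] at ht
        by_contra! hneg
        linarith [mul_pos_of_neg_of_neg hneg ha]
      have hβ : 0 ≤ β := by
        obtain ⟨w, hw0, hw, -⟩ := hsign a
        have hb := hw b ⟨hab, hab'⟩
        have ht : 0 ≤ w ⬝ᵥ c (T i) := by
          rcases (hTmem i).1.eq_or_lt with h' | h'
          · rw [← h', hw0]
          · exact (hw _ ⟨h', by linarith [(hTmem i).2]⟩).le
        rw [h, dotProduct_add, dotProduct_smul, dotProduct_smul, hw0, smul_zero, zero_add,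
          smul_eq_mul] at ht
        exact nonneg_of_mul_nonneg_left ht hb
      refine ⟨α, β, hα, hβ, (add_nonneg hα hβ).lt_of_ne' fun h0 => ?_, h⟩
      obtain rfl : α = 0 := by linarith
      obtain rfl : β = 0 := by linarith
      have := hunit (T i)
      simp [h] at this
    choose α β hα hβ hσ hcT using hcoord
    refine ⟨fun i => β i / (α i + β i), ?_, fun i => ⟨div_nonneg (hβ i) (hσ i).le, ?_⟩,
      fun i => Or.inl ?_⟩
    · intro i j hij
      rcases hij.eq_or_lt with rfl | hlt
      · exact le_rfl
      obtain ⟨w, hw0, hw, -⟩ := hsign (T i)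
      have hTij := hT hlt
      have hb := hw b ⟨hTij.trans_le (hTmem j).2, by linarith [(hTmem i).1]⟩
      have hj := hw (T j) ⟨hTij, by linarith [(hTmem i).1, (hTmem j).2]⟩
      rw [hcT i, dotProduct_add, dotProduct_smul, dotProduct_smul, smul_eq_mul,
        smul_eq_mul] at hw0
      rw [hcT j, dotProduct_add, dotProduct_smul, dotProduct_smul, smul_eq_mul,
        smul_eq_mul] at hj
      have hprod : 0 ≤ (α i * β j - α j * β i) * (w ⬝ᵥ c b) := by
        linear_combination mul_nonneg (hα i) hj.le + α j * hw0
      have hdet := nonneg_of_mul_nonneg_left hprod hb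
      simp only
      rw [div_le_div_iff₀ (hσ i) (hσ j)]
      linarith
    · exact (div_le_one (hσ i)).2 (by linarith [hα i])
    · have h : (1 - β i / (α i + β i)) • c a + (β i / (α i + β i)) • (1 : ℝ) • c b =
          (α i + β i)⁻¹ • c (T i) := by
        have := (hσ i).ne'
        rw [hcT i, one_smul, smul_add, smul_smul, smul_smul]
        congr 2
        · field_simp
          ring
        · field_simp
      rw [h, unitize_smul_of_unit (hunit _) (inv_pos.2 (hσ i))]


end
end
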